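/- arXiv:1311.0451 — 3 statements merged into one kernel-verified Lean document; each statement's English description precedes it below -/
import Mathlib

section
/- Let (X,f) be a non-wandering dynamical system with the shadowing property such that the set of sensitive points of (X,f) is dense in X. Then the set of points that are recurrent but not minimal is dense in X, and the set of points that are minimal but not regularly recurrent is dense in X. -/
open Set Function

variable {X : Type*}

/-- A `δ`-pseudo-orbit of `f`. -/
def IsPseudoOrbit [MetricSpace X] (f : X → X) (δ : ℝ) (x : ℕ → X) : Prop :=
  ∀ n : ℕ, dist (f (x n)) (x (n + 1)) < δ

/-- `z` ε-traces the sequence `x`. -/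
def Traces [MetricSpace X] (f : X → X) (ε : ℝ) (z : X) (x : ℕ → X) : Prop :=
  ∀ n : ℕ, dist (f^[n] z) (x n) < ε

/-- The shadowing property. -/
def HasShadowing [MetricSpace X] (f : X → X) : Prop :=
  ∀ ε > (0 : ℝ), ∃ δ > (0 : ℝ), ∀ x : ℕ → X, IsPseudoOrbit f δ x → ∃ z : X, Traces f ε z x

/-- The shadowing property of the restriction of `f` to an invariant set `S`. -/
def HasShadowingOn [MetricSpace X] (f : X → X) (S : Set X) : Prop :=
  ∀ ε > (0 : ℝ), ∃ δ > (0 : ℝ), ∀ x : ℕ → X, (∀ n, x n ∈ S) → IsPseudoOrbit f δ x →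
    ∃ z ∈ S, Traces f ε z x

/-- Non-wandering point. -/
def NonWanderingPt [TopologicalSpace X] (f : X → X) (x : X) : Prop :=
  ∀ U ∈ nhds x, ∃ k : ℕ, 1 ≤ k ∧ ∃ y ∈ U, f^[k] y ∈ U

/-- The (forward) orbit of a point. -/
def orbitSet (f : X → X) (x : X) : Set X := Set.range fun n : ℕ => f^[n] x

/-- Recurrent point. -/
def RecurrentPt [TopologicalSpace X] (f : X → X) (x : X) : Prop :=
  ∀ U ∈ nhds x, ∃ k : ℕ, 1 ≤ k ∧ f^[k] x ∈ U

/-- Minimal point: every point of the orbit closure has `x` in its own orbit closure,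
i.e. the orbit closure of `x` is a minimal set. -/
def MinimalPt [TopologicalSpace X] (f : X → X) (x : X) : Prop :=
  ∀ y ∈ closure (orbitSet f x), x ∈ closure (orbitSet f y)

/-- Regularly recurrent point. -/
def RegRecPt [TopologicalSpace X] (f : X → X) (x : X) : Prop :=
  ∀ U ∈ nhds x, ∃ k : ℕ, 1 ≤ k ∧ ∀ n : ℕ, f^[k * n] x ∈ U

/-- Equicontinuity of the family of iterates of `f`. -/
def EquicontinuousMap [MetricSpace X] (f : X → X) : Prop :=
  ∀ ε > (0 : ℝ), ∃ δ > (0 : ℝ), ∀ x y : X, dist x y < δ →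
    ∀ n : ℕ, dist (f^[n] x) (f^[n] y) < ε

/-- `u` is a sensitive point of the subsystem on `S`. -/
def SensitivePtOn [MetricSpace X] (f : X → X) (S : Set X) (u : X) : Prop :=
  ∃ δ > (0 : ℝ), ∀ U ∈ nhds u, ∃ n : ℕ, ∃ a ∈ U ∩ S, ∃ b ∈ U ∩ S,
    dist (f^[n] a) (f^[n] b) > δ

/-- `u` is a sensitive point of `(X,f)`. -/
def SensitivePt [MetricSpace X] (f : X → X) (u : X) : Prop :=
  ∃ δ > (0 : ℝ), ∀ U ∈ nhds u, ∃ n : ℕ, ∃ a ∈ U, ∃ b ∈ U,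
    dist (f^[n] a) (f^[n] b) > δ

/-- Topological transitivity. -/
def TopTransitive {Y : Type*} [TopologicalSpace Y] (g : Y → Y) : Prop :=
  ∀ U V : Set Y, IsOpen U → U.Nonempty → IsOpen V → V.Nonempty →
    ∃ n : ℕ, 1 ≤ n ∧ (g^[n] '' U ∩ V).Nonempty

/-- Weak mixing: the product system is transitive. -/
def WeaklyMixing [TopologicalSpace X] (f : X → X) : Prop :=
  TopTransitive (fun p : X × X => (f p.1, f p.2))

/-- Strong mixing. -/
def StronglyMixing {Y : Type*} [TopologicalSpace Y] (g : Y → Y) : Prop :=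
  ∀ U V : Set Y, IsOpen U → U.Nonempty → IsOpen V → V.Nonempty →
    ∃ N : ℕ, ∀ n ≥ N, (g^[n] '' U ∩ V).Nonempty

/-- The shift map on the full shift over `d` symbols. -/
def shiftMap (d : ℕ) : (ℕ → Fin d) → (ℕ → Fin d) := fun x n => x (n + 1)

/-- `π` is a factor map from the subsystem `(Y, f^[m])` onto the full shift on `d` symbols. -/
def FactorOntoShift [TopologicalSpace X] (f : X → X) (m : ℕ) (Y : Set X) (d : ℕ)
    (π : X → (ℕ → Fin d)) : Prop :=
  ContinuousOn π Y ∧ π '' Y = Set.univ ∧ ∀ y ∈ Y, π (f^[m] y) = shiftMap d (π y)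

lemma self_mem_orbitSet (g : X → X) (x : X) : x ∈ orbitSet g x := ⟨0, rfl⟩

section Invariant

variable [TopologicalSpace X] {f g : X → X} {K : Set X} {x y : X}

lemma mapsTo_closure_orbitSet (hg : Continuous g) (x : X) :
    MapsTo g (closure (orbitSet g x)) (closure (orbitSet g x)) := by
  refine MapsTo.closure ?_ hg
  rintro _ ⟨n, rfl⟩
  exact ⟨n + 1, iterate_succ_apply' g n x⟩

lemma closure_orbitSet_subset (hK : IsClosed K) (hgK : MapsTo g K K) (hx : x ∈ K) :
    closure (orbitSet g x) ⊆ K :=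
  closure_minimal (by rintro _ ⟨n, rfl⟩; exact hgK.iterate n hx) hK

lemma closure_orbitSet_iterate_subset (f : X → X) (m : ℕ) (x : X) :
    closure (orbitSet f^[m] x) ⊆ closure (orbitSet f x) := by
  refine closure_mono ?_
  rintro _ ⟨n, rfl⟩
  exact ⟨m * n, by simp only [iterate_mul]⟩

/-- A closed `f^[m]`-invariant set is visited by the `f`-orbit of every point in the
`f`-orbit closure of any of its points. -/
lemma exists_iterate_mem_of_mem_closure_orbitSet (hf : Continuous f) {m : ℕ} (hm : 0 < m)
    (hK : IsClosed K) (hfK : MapsTo f^[m] K K) (hx : x ∈ K)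
    (hy : y ∈ closure (orbitSet f x)) : ∃ r, f^[r] y ∈ K := by
  have hclosed : IsClosed (⋃ r ∈ Finset.range (m + 1), f^[r] ⁻¹' K) :=
    isClosed_biUnion_finset fun r _ => hK.preimage (hf.iterate r)
  have hsub : orbitSet f x ⊆ ⋃ r ∈ Finset.range (m + 1), f^[r] ⁻¹' K := by
    rintro _ ⟨i, rfl⟩
    simp only [mem_iUnion, Finset.mem_range, mem_preimage, exists_prop]
    refine ⟨m - i % m, by omega, ?_⟩
    have hi : m - i % m + i = m * (i / m + 1) := by
      have h1 := Nat.mod_lt i hm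
      have h2 := Nat.div_add_mod i m
      rw [mul_add, mul_one]
      omega
    rw [← iterate_add_apply, hi, iterate_mul]
    exact hfK.iterate _ hx
  have := closure_minimal hsub hclosed hy
  simp only [mem_iUnion, mem_preimage] at this
  obtain ⟨r, _, hr⟩ := this
  exact ⟨r, hr⟩

/-- Among the closed invariant subsets of `K` meeting each of the closed sets `E i`, there is a
minimal one. -/
lemma exists_minimal_invariant_meeting [CompactSpace X] {ι : Type*} (g : X → X) {E : ι → Set X}
    (hE : ∀ i, IsClosed (E i)) (hK : IsClosed K) (hgK : MapsTo g K K)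
    (hKE : ∀ i, (K ∩ E i).Nonempty) :
    ∃ M ⊆ K, IsClosed M ∧ MapsTo g M M ∧ (∀ i, (M ∩ E i).Nonempty) ∧
      ∀ N ⊆ M, IsClosed N → MapsTo g N N → (∀ i, (N ∩ E i).Nonempty) → N = M := by
  obtain ⟨M, hMK, hM⟩ := zorn_superset_nonempty
    {M : Set X | IsClosed M ∧ MapsTo g M M ∧ ∀ i, (M ∩ E i).Nonempty} (by
      intro c hc hchain hne
      refine ⟨⋂₀ c, ⟨isClosed_sInter fun s hs => (hc hs).1, ?_, ?_⟩,
        fun s hs => sInter_subset_of_mem hs⟩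
      · exact fun x hx s hs => (hc hs).2.1 (hx s hs)
      · intro i
        have : Nonempty c := hne.to_subtype
        have key := IsCompact.nonempty_iInter_of_directed_nonempty_isCompact_isClosed
          (fun s : c => (s : Set X) ∩ E i)
          (fun s t => by
            rcases hchain.total s.2 t.2 with h | h
            · exact ⟨s, subset_rfl, inter_subset_inter_left _ h⟩
            · exact ⟨t, inter_subset_inter_left _ h, subset_rfl⟩)
          (fun s => (hc s.2).2.2 i)
          (fun s => ((hc s.2).1.inter (hE i)).isCompact)
          (fun s => (hc s.2).1.inter (hE i))
        obtain ⟨z, hz⟩ := key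
        simp only [mem_iInter] at hz
        exact ⟨z, fun s hs => (hz ⟨s, hs⟩).1, (hz (Classical.arbitrary c)).2⟩)
    K ⟨hK, hgK, hKE⟩
  exact ⟨M, hMK, hM.prop.1, hM.prop.2.1, hM.prop.2.2, fun N hNM h1 h2 h3 =>
    (hM.eq_of_superset ⟨h1, h2, h3⟩ hNM).symm⟩

/-- In a non-wandering system, the return times of a nonempty open set are unbounded. -/
lemma exists_large_return_time (hf : Continuous f) (hnw : ∀ x, NonWanderingPt f x) (n : ℕ)
    {W : Set X} (hW : IsOpen W) (hne : W.Nonempty) : ∃ k > n, ∃ y ∈ W, f^[k] y ∈ W := by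
  induction n generalizing W with
  | zero =>
    obtain ⟨x, hx⟩ := hne
    exact hnw x W (hW.mem_nhds hx)
  | succ n ih =>
    obtain ⟨k, hk, y, hy, hky⟩ := ih hW hne
    obtain ⟨x, hx⟩ : (W ∩ f^[k] ⁻¹' W).Nonempty := ⟨y, hy, hky⟩
    obtain ⟨l, hl, z, hz, hlz⟩ :=
      hnw x _ ((hW.inter (hW.preimage (hf.iterate k))).mem_nhds hx)
    refine ⟨k + l, by omega, z, hz.1, ?_⟩
    rw [iterate_add_apply]
    exact hlz.2

end Invariant

section Sequences

/-- There is a binary sequence in which every finite word occurs at a positive position. -/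
lemma exists_seq_containing_words :
    ∃ s : ℕ → Bool, ∀ (t : ℕ → Bool) (L : ℕ), ∃ p, ∀ i < L, s (p + 1 + i) = t i := by
  refine ⟨fun i => (Nat.log 2 i).testBit (i - 2 ^ Nat.log 2 i), fun t L => ?_⟩
  obtain ⟨n, hn, hnt⟩ : ∃ n, L ≤ n ∧ ∀ i < L, n.testBit i = t i := by
    refine ⟨2 ^ L + Nat.ofBits fun i : Fin L => t i, ?_, fun i hi => ?_⟩
    · exact (Nat.lt_two_pow_self (n := L)).le.trans (Nat.le_add_right _ _)
    · rw [Nat.testBit_two_pow_add_gt hi]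
      simp [Nat.testBit_ofBits_lt, hi]
  have hpos := Nat.two_pow_pos n
  refine ⟨2 ^ n - 1, fun i hi => ?_⟩
  have hi' : i < 2 ^ n := (hi.trans_le hn).trans Nat.lt_two_pow_self
  have hlog : Nat.log 2 (2 ^ n + i) = n := by
    rw [Nat.log_eq_iff (by simp)]
    exact ⟨Nat.le_add_right _ _, by rw [pow_succ]; omega⟩
  have : 2 ^ n - 1 + 1 + i = 2 ^ n + i := by omega
  simp only [this, hlog, Nat.add_sub_cancel_left]
  exact hnt i hi

/-- There is a binary sequence whose monochromatic arithmetic progressions of any given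
difference have bounded length. -/
lemma exists_seq_bounded_monochromatic :
    ∃ (t : ℕ → Bool) (N : ℕ → ℕ), ∀ k ≥ 1, ∀ p, ∃ n ≤ N k, t (p + k * n) ≠ t p := by
  have hbd : ∀ k : ℕ, ∃ N : ℕ, 1 ≤ k → ∀ p : ℕ, ∃ n ≤ N,
      decide (Even ⌊((p + k * n : ℕ) : ℝ) * √2⌋) ≠ decide (Even ⌊(p : ℝ) * √2⌋) := by
    intro k
    rcases Nat.eq_zero_or_pos k with rfl | hk
    · exact ⟨0, by simp⟩
    set c : ℤ := round ((k : ℝ) * √2 / 2) with hc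
    set β : ℝ := k * √2 - 2 * c with hβ
    have hβ1 : |β| ≤ 1 := by
      have := abs_sub_round ((k : ℝ) * √2 / 2)
      rw [← hc] at this
      rw [abs_le] at this ⊢
      constructor <;> linarith [this.1, this.2]
    have hβ0 : 0 < |β| := by
      rw [abs_pos, hβ, sub_ne_zero]
      have h := (irrational_sqrt_two.natCast_mul hk.ne').ne_int (2 * c)
      push_cast at h
      exact h
    obtain ⟨N, hN⟩ := exists_nat_ge (1 / |β|)
    refine ⟨N, fun _ p => ?_⟩
    by_contra! hcon
    have hparity : ∀ n ≤ N, (Even ⌊(p : ℝ) * √2 + n * β⌋ ↔ Even ⌊(p : ℝ) * √2⌋) := by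
      intro n hn
      have h1 : ((p + k * n : ℕ) : ℝ) * √2 = (p : ℝ) * √2 + n * β + ((2 * c * n : ℤ) : ℝ) := by
        push_cast
        rw [hβ]
        ring
      have h2 := decide_eq_decide.1 (hcon n hn)
      rw [h1, Int.floor_add_intCast, Int.even_add] at h2
      have h3 : Even (2 * c * (n : ℤ)) := by simp [mul_assoc]
      tauto
    have hfloor : ∀ n ≤ N, ⌊(p : ℝ) * √2 + n * β⌋ = ⌊(p : ℝ) * √2⌋ := by
      intro n
      induction n with
      | zero => simp
      | succ n ih =>
        intro hn
        have h0 := ih (by omega)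
        have h1 := hparity (n + 1) hn
        have a1 := Int.floor_le ((p : ℝ) * √2 + n * β)
        have a2 := Int.lt_floor_add_one ((p : ℝ) * √2 + n * β)
        have b1 := Int.floor_le ((p : ℝ) * √2 + (n + 1 : ℕ) * β)
        have b2 := Int.lt_floor_add_one ((p : ℝ) * √2 + (n + 1 : ℕ) * β)
        rw [h0] at a1 a2
        obtain ⟨hl, hu⟩ := abs_le.1 hβ1
        have e1 : ⌊(p : ℝ) * √2 + (n + 1 : ℕ) * β⌋ < ⌊(p : ℝ) * √2⌋ + 2 := by
          have : (⌊(p : ℝ) * √2 + (n + 1 : ℕ) * β⌋ : ℝ) < ⌊(p : ℝ) * √2⌋ + 2 := by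
            push_cast at b1 ⊢
            linarith
          exact_mod_cast this
        have e2 : ⌊(p : ℝ) * √2⌋ < ⌊(p : ℝ) * √2 + (n + 1 : ℕ) * β⌋ + 2 := by
          have : (⌊(p : ℝ) * √2⌋ : ℝ) < ⌊(p : ℝ) * √2 + (n + 1 : ℕ) * β⌋ + 2 := by
            push_cast at b2 ⊢
            linarith
          exact_mod_cast this
        rw [Int.even_iff, Int.even_iff] at h1
        omega
    have h1 := hfloor N le_rfl
    have a1 := Int.floor_le ((p : ℝ) * √2 + N * β)
    have a2 := Int.lt_floor_add_one ((p : ℝ) * √2 + N * β)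
    have b1 := Int.floor_le ((p : ℝ) * √2)
    have b2 := Int.lt_floor_add_one ((p : ℝ) * √2)
    rw [h1] at a1 a2
    have hlt : |(N : ℝ) * β| < 1 := by
      rw [abs_lt]
      constructor <;> linarith
    rw [abs_mul, Nat.abs_cast] at hlt
    rw [div_le_iff₀ hβ0] at hN
    linarith
  choose N hN using hbd
  exact ⟨fun i => decide (Even ⌊(i : ℝ) * √2⌋), N, hN⟩

end Sequences

section Horseshoe

/-- `D` is a two-symbol horseshoe for `g`: disjoint closed sets along which every itinerary is
realised. -/
structure IsHorseshoe [TopologicalSpace X] (g : X → X) (D : Bool → Set X) : Prop where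
  isClosed : ∀ c, IsClosed (D c)
  disjoint : Disjoint (D false) (D true)
  exists_itinerary : ∀ s : ℕ → Bool, ∃ z, ∀ i, g^[i] z ∈ D (s i)

/-- The first `k` points of the orbit of `y`, followed by the orbit of `y'`. -/
def concatOrbit (f : X → X) (k : ℕ) (y y' : X) (j : ℕ) : X :=
  if j < k then f^[j] y else f^[j - k] y'

lemma isPseudoOrbit_of_blocks [MetricSpace X] {f : X → X} {η : ℝ} {m : ℕ} (hm : 0 < m)
    {B : Bool → ℕ → X} (hstep : ∀ c j, j + 1 < m → dist (f (B c j)) (B c (j + 1)) < η)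
    (hjoin : ∀ c c' j, j + 1 = m → dist (f (B c j)) (B c' 0) < η) (s : ℕ → Bool) :
    IsPseudoOrbit f η fun i => B (s (i / m)) (i % m) := by
  intro i
  have hlt := Nat.mod_lt i hm
  have hdiv := Nat.div_add_mod i m
  dsimp only
  rcases Nat.lt_or_ge (i % m + 1) m with h | h
  · have e : i + 1 = (i % m + 1) + m * (i / m) := by omega
    have e1 : (i + 1) / m = i / m := by
      rw [e, Nat.add_mul_div_left _ _ hm, Nat.div_eq_of_lt h, zero_add]
    have e2 : (i + 1) % m = i % m + 1 := by
      rw [e, Nat.add_mul_mod_self_left, Nat.mod_eq_of_lt h]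
    rw [e1, e2]
    exact hstep _ _ h
  · have h' : i % m + 1 = m := by omega
    have e2 : (i + 1) % m = 0 := by
      have e : i + 1 = m * (i / m + 1) := by rw [mul_add, mul_one]; omega
      rw [e, Nat.mul_mod_right]
    rw [e2]
    exact hjoin _ _ _ h'

lemma dist_concatOrbit_step [MetricSpace X] {f : X → X} {η : ℝ} (hη : 0 < η) {k : ℕ} {y y' : X}
    (h : dist (f^[k] y) y' < η) (j : ℕ) :
    dist (f (concatOrbit f k y y' j)) (concatOrbit f k y y' (j + 1)) < η := by
  unfold concatOrbit
  rcases lt_trichotomy (j + 1) k with h1 | h1 | h1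
  · rw [if_pos (by omega), if_pos h1, iterate_succ_apply', dist_self]
    exact hη
  · rw [if_pos (by omega), if_neg (by omega), ← iterate_succ_apply' f, Nat.succ_eq_add_one, h1,
      Nat.sub_self]
    exact h
  · rw [if_neg (by omega), if_neg (by omega), Nat.sub_add_comm (by omega), iterate_succ_apply',
      dist_self]
    exact hη

/-- Near a sensitive point of a non-wandering system with shadowing, some iterate has a
horseshoe. -/
lemma exists_isHorseshoe [MetricSpace X] {f : X → X} (hf : Continuous f)
    (hnw : ∀ x, NonWanderingPt f x) (hsh : HasShadowing f) {u : X} (hu : SensitivePt f u)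
    {U : Set X} (hU : U ∈ nhds u) :
    ∃ m > 0, ∃ D : Bool → Set X, IsHorseshoe f^[m] D ∧ ∀ c, D c ⊆ U := by
  obtain ⟨δ, hδ, hsens⟩ := hu
  obtain ⟨r, hr, hrU⟩ := Metric.mem_nhds_iff.1 hU
  obtain ⟨ε, hε, hε1, hε2⟩ : ∃ ε > 0, 4 * ε ≤ δ ∧ 4 * ε ≤ r :=
    ⟨min δ r / 4, by positivity, by linarith [min_le_left δ r], by linarith [min_le_right δ r]⟩
  obtain ⟨η, hη, htrace⟩ := hsh ε hε
  set V := Metric.ball u (min (η / 2) ε)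
  have hVpos : 0 < min (η / 2) ε := lt_min (by linarith) hε
  have hVη : ∀ p ∈ V, ∀ q ∈ V, dist p q < η := by
    intro p hp q hq
    have h1 := (Metric.mem_ball.1 hp).trans_le (min_le_left _ _)
    have h2 := (Metric.mem_ball'.1 hq).trans_le (min_le_left _ _)
    linarith [dist_triangle p u q]
  obtain ⟨n, a, ha, b, hb, hab⟩ := hsens V (Metric.ball_mem_nhds u hVpos)
  have hret : ∀ e ∈ V, ∃ k > n, ∃ y ∈ V, dist (f^[n] y) (f^[n] e) < ε ∧ f^[k] y ∈ V := by
    intro e he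
    obtain ⟨k, hk, y, hy, hky⟩ := exists_large_return_time hf hnw n
      (Metric.isOpen_ball.inter (Metric.isOpen_ball.preimage (hf.iterate n)) :
        IsOpen (V ∩ f^[n] ⁻¹' Metric.ball (f^[n] e) ε)) ⟨e, he, Metric.mem_ball_self hε⟩
    exact ⟨k, hk, y, hy.1, hy.2, hky.1⟩
  obtain ⟨k, hk, y, hy, hya, hky⟩ := hret a ha
  obtain ⟨l, hl, z, hz, hzb, hlz⟩ := hret b hb
  set B : Bool → ℕ → X := fun c => if c then concatOrbit f k y z else concatOrbit f l z y with hB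
  set e : Bool → X := fun c => if c then a else b with he
  have hm : 0 < k + l := by omega
  have hB0 : ∀ c, B c 0 ∈ V := by
    intro c
    cases c <;> simp [hB, concatOrbit, show 0 < k by omega, show 0 < l by omega, hy, hz]
  have hBn : ∀ c, dist (B c n) (f^[n] (e c)) < ε := by
    intro c
    cases c <;> simp [hB, he, concatOrbit, hk, hl, hya, hzb]
  refine ⟨k + l, hm, fun c => Metric.closedBall u (2 * ε) ∩
    f^[n] ⁻¹' Metric.closedBall (f^[n] (e c)) (2 * ε), ⟨fun c => ?_, ?_, fun s => ?_⟩, fun c => ?_⟩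
  · exact Metric.isClosed_closedBall.inter
      (Metric.isClosed_closedBall.preimage (hf.iterate n))
  · rw [Set.disjoint_left]
    rintro x ⟨-, h1⟩ ⟨-, h2⟩
    have h1 : dist (f^[n] x) (f^[n] b) ≤ 2 * ε := h1
    have h2 : dist (f^[n] x) (f^[n] a) ≤ 2 * ε := h2
    linarith [dist_triangle_left (f^[n] a) (f^[n] b) (f^[n] x)]
  · have hpo : IsPseudoOrbit f η fun i => B (s (i / (k + l))) (i % (k + l)) := by
      refine isPseudoOrbit_of_blocks hm (fun c j _ => ?_) (fun c c' j hj => ?_) s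
      · cases c
        · exact dist_concatOrbit_step hη (hVη _ hlz _ hy) j
        · exact dist_concatOrbit_step hη (hVη _ hky _ hz) j
      · refine hVη _ ?_ _ (hB0 c')
        cases c
        · have : j - l + 1 = k := by omega
          simp only [hB, concatOrbit, Bool.false_eq_true, if_false]
          rwa [if_neg (by omega), ← iterate_succ_apply' f, Nat.succ_eq_add_one, this]
        · have : j - k + 1 = l := by omega
          simp only [hB, concatOrbit, if_true]
          rwa [if_neg (by omega), ← iterate_succ_apply' f, Nat.succ_eq_add_one, this]
    obtain ⟨w, hw⟩ := htrace _ hpo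
    refine ⟨w, fun i => ?_⟩
    have h0 := hw ((k + l) * i)
    have hn := hw (n + (k + l) * i)
    simp only [Nat.mul_div_cancel_left _ hm, Nat.mul_mod_right] at h0
    dsimp only at hn
    rw [Nat.add_mul_div_left _ _ hm, Nat.add_mul_mod_self_left,
      Nat.div_eq_of_lt (by omega), Nat.mod_eq_of_lt (by omega), zero_add, iterate_add_apply] at hn
    rw [← iterate_mul]
    constructor
    · have h1 := (Metric.mem_ball.1 (hB0 (s i))).trans_le (min_le_right _ _)
      rw [Metric.mem_closedBall]
      linarith [dist_triangle (f^[(k + l) * i] w) (B (s i) 0) u]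
    · rw [mem_preimage, Metric.mem_closedBall]
      linarith [dist_triangle (f^[n] (f^[(k + l) * i] w)) (B (s i) n) (f^[n] (e (s i))),
        hBn (s i)]
  · exact fun x hx => hrU (Metric.closedBall_subset_ball (by linarith) hx.1)

variable [TopologicalSpace X] [CompactSpace X] {f : X → X} {m : ℕ} {D : Bool → Set X}

lemma IsHorseshoe.exists_recurrentPt_not_minimalPt (hf : Continuous f) (hm : 0 < m)
    (hD : IsHorseshoe f^[m] D) : ∃ c, ∃ x ∈ D c, RecurrentPt f x ∧ ¬ MinimalPt f x := by
  have hg := hf.iterate m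
  set g := f^[m] with hg_def
  set E : (ℕ → Bool) → Set X := fun s => {z | ∀ i, g^[i] z ∈ D (s i)} with hE
  have hEc : ∀ s, IsClosed (E s) := by
    intro s
    simp only [hE, ofPred_forall]
    exact isClosed_iInter fun i => (hD.isClosed _).preimage (hg.iterate i)
  obtain ⟨W, -, hWc, hgW, hWE, hWmin⟩ := exists_minimal_invariant_meeting g hEc isClosed_univ
    (mapsTo_univ g univ) (fun s => by rw [univ_inter]; exact hD.exists_itinerary s)
  obtain ⟨s, hs⟩ := exists_seq_containing_words
  obtain ⟨w, hwW, hws⟩ := hWE s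
  have horb : closure (orbitSet g (g w)) = W := by
    refine hWmin _ (closure_orbitSet_subset hWc hgW (hgW hwW)) isClosed_closure
      (mapsTo_closure_orbitSet hg _) fun t => ?_
    set F : ℕ → Set X := fun L =>
      closure (orbitSet g (g w)) ∩ ⋂ i ∈ Finset.range L, g^[i] ⁻¹' D (t i)
    have hFc : ∀ L, IsClosed (F L) := fun L => isClosed_closure.inter
      (isClosed_biInter fun i _ => (hD.isClosed _).preimage (hg.iterate i))
    obtain ⟨z, hz⟩ := IsCompact.nonempty_iInter_of_sequence_nonempty_isCompact_isClosed F
      (fun L => inter_subset_inter_right _ <| biInter_subset_biInter_left fun i hi => by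
        simp only [Finset.mem_coe, Finset.mem_range] at hi ⊢; omega)
      (fun L => by
        obtain ⟨p, hp⟩ := hs t L
        refine ⟨g^[p] (g w), subset_closure ⟨p, rfl⟩, ?_⟩
        simp only [mem_iInter, Finset.mem_range, mem_preimage]
        intro i hi
        rw [← hp i hi, ← iterate_succ_apply, ← iterate_add_apply, add_comm i]
        exact hws _)
      (hFc 0).isCompact hFc
    rw [mem_iInter] at hz
    refine ⟨z, (hz 0).1, fun i => ?_⟩
    have := (hz (i + 1)).2
    simp only [mem_iInter, Finset.mem_range, mem_preimage] at this
    exact this i (by omega)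
  refine ⟨s 0, w, hws 0, fun U hU => ?_, fun hmin => ?_⟩
  · obtain ⟨_, hxU, i, rfl⟩ := mem_closure_iff_nhds.1 (horb.symm ▸ hwW) U hU
    refine ⟨m * (i + 1), Nat.mul_pos hm i.succ_pos, ?_⟩
    rw [iterate_mul]
    exact hxU
  · obtain ⟨y, hyW, hy⟩ := hWE fun _ => true
    have hWw : W ⊆ closure (orbitSet g w) := horb ▸ closure_orbitSet_subset isClosed_closure
      (mapsTo_closure_orbitSet hg w) (mapsTo_closure_orbitSet hg w
        (subset_closure (self_mem_orbitSet g w)))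
    set K := closure (orbitSet g y)
    have hgK : MapsTo g K K := mapsTo_closure_orbitSet hg y
    have hKE : K ⊆ E fun _ => true := closure_orbitSet_subset (hEc _)
      (fun z hz i => hz (i + 1)) hy
    have hKW : K ⊆ W := closure_orbitSet_subset hWc hgW hyW
    obtain ⟨r, hr⟩ := exists_iterate_mem_of_mem_closure_orbitSet hf hm isClosed_closure hgK
      (subset_closure (self_mem_orbitSet g y))
      (hmin y (closure_orbitSet_iterate_subset f m w (hWw hyW)))
    have hrW : MapsTo f^[r] W K := by
      have hclosed : IsClosed (f^[r] ⁻¹' K) := isClosed_closure.preimage (hf.iterate r)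
      refine fun v hv => closure_minimal ?_ hclosed (hWw hv)
      rintro _ ⟨i, rfl⟩
      have hcomm : f^[r] (g^[i] w) = g^[i] (f^[r] w) := by
        rw [hg_def, ← iterate_mul, ← iterate_add_apply, add_comm, iterate_add_apply]
      rw [mem_preimage, hcomm]
      exact hgK.iterate i hr
    have hgrw : g^[r] w ∈ K := by
      have h : ∀ i, f^[r * (i + 1)] w ∈ K := by
        intro i
        induction i with
        | zero => simpa using hr
        | succ i ih =>
          rw [mul_add _ (i + 1), mul_one, add_comm, iterate_add_apply]
          exact hrW (hKW ih)
      have h' := h (m - 1)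
      rwa [Nat.sub_add_cancel hm, mul_comm, iterate_mul] at h'
    obtain ⟨p, hp⟩ := hs (fun _ => false) (r + 1)
    have h1 : g^[p + 1 + r] w ∈ D false := hp r (by omega) ▸ hws (p + 1 + r)
    have h2 : g^[p + 1 + r] w ∈ D true := by
      rw [iterate_add_apply]
      exact hKE hgrw (p + 1)
    exact Set.disjoint_left.1 hD.disjoint h1 h2

lemma IsHorseshoe.exists_minimalPt_not_regRecPt (hf : Continuous f) (hm : 0 < m)
    (hD : IsHorseshoe f^[m] D) : ∃ c, ∃ x ∈ D c, MinimalPt f x ∧ ¬ RegRecPt f x := by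
  have hg := hf.iterate m
  set g := f^[m] with hg_def
  obtain ⟨t, N, hN⟩ := exists_seq_bounded_monochromatic
  set W : Set X := {x | ∀ k ≥ 1, ∀ p, ∃ n ∈ Finset.range (N k + 1), ∃ c ∈ Finset.univ,
    g^[p] x ∈ D c ∧ g^[p + k * n] x ∈ D !c} with hW
  have hWc : IsClosed W := by
    simp only [hW, ofPred_forall]
    refine isClosed_iInter fun k => isClosed_iInter fun _ => isClosed_iInter fun p => ?_
    have : {x | ∃ n ∈ Finset.range (N k + 1), ∃ c ∈ Finset.univ,
        g^[p] x ∈ D c ∧ g^[p + k * n] x ∈ D !c} =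
        ⋃ n ∈ Finset.range (N k + 1), ⋃ c ∈ (Finset.univ : Finset Bool),
          (g^[p] ⁻¹' D c ∩ g^[p + k * n] ⁻¹' D !c) := by
      ext x
      simp
    rw [this]
    exact isClosed_biUnion_finset fun n _ => isClosed_biUnion_finset fun c _ =>
      ((hD.isClosed _).preimage (hg.iterate _)).inter ((hD.isClosed _).preimage (hg.iterate _))
  have hgW : MapsTo g W W := by
    intro x hx k hk p
    obtain ⟨n, hn, c, hc, h1, h2⟩ := hx k hk (p + 1)
    refine ⟨n, hn, c, hc, h1, ?_⟩
    rwa [← iterate_succ_apply, Nat.succ_eq_add_one, add_right_comm]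
  have hWne : W.Nonempty := by
    obtain ⟨z, hz⟩ := hD.exists_itinerary t
    refine ⟨z, fun k hk p => ?_⟩
    obtain ⟨n, hn, hne⟩ := hN k hk p
    refine ⟨n, Finset.mem_range.2 (by omega), t p, Finset.mem_univ _, hz p, ?_⟩
    rw [← Bool.eq_not_of_ne hne]
    exact hz _
  obtain ⟨M, hMW, hMc, hgM, hME, hMmin⟩ := exists_minimal_invariant_meeting g
    (E := fun _ : Unit => univ) (fun _ => isClosed_univ) hWc hgW (fun _ => by simpa using hWne)
  obtain ⟨x, hx, -⟩ := hME ()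
  obtain ⟨-, -, c, -, hxc, -⟩ := hMW hx 1 le_rfl 0
  refine ⟨c, x, hxc, fun y hy => ?_, fun hreg => ?_⟩
  · obtain ⟨r, hr⟩ := exists_iterate_mem_of_mem_closure_orbitSet hf hm hMc hgM hx hy
    have horb : closure (orbitSet g (f^[r] y)) = M :=
      hMmin _ (closure_orbitSet_subset hMc hgM hr) isClosed_closure
        (mapsTo_closure_orbitSet hg _)
        fun _ => ⟨_, subset_closure (self_mem_orbitSet _ _), mem_univ _⟩
    have h1 := closure_orbitSet_iterate_subset f m (f^[r] y) (horb.symm ▸ hx)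
    refine closure_mono ?_ h1
    rintro _ ⟨i, rfl⟩
    exact ⟨i + r, iterate_add_apply f i r y⟩
  · have hdisj : ∀ c, Disjoint (D c) (D !c) := by
      rintro (_ | _)
      · exact hD.disjoint
      · exact hD.disjoint.symm
    obtain ⟨k, hk, hkU⟩ := hreg (D !c)ᶜ
      ((hD.isClosed _).isOpen_compl.mem_nhds (Set.disjoint_left.1 (hdisj c) hxc))
    obtain ⟨n, -, c', -, h1, h2⟩ := hMW hx k hk 0
    have hc : c' = c := by
      by_contra hne
      rw [Bool.eq_not_of_ne hne] at h1
      exact Set.disjoint_left.1 (hdisj c) hxc h1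
    subst hc
    refine hkU (m * n) ?_
    rwa [zero_add, hg_def, ← iterate_mul, mul_left_comm] at h2

end Horseshoe

theorem dense_sensitive_points_consequences [MetricSpace X] [CompactSpace X]
    (f : X → X) (hf : Continuous f) (hnw : ∀ x : X, NonWanderingPt f x)
    (hsh : HasShadowing f) (hdense : Dense {u : X | SensitivePt f u}) :
    Dense {x : X | RecurrentPt f x ∧ ¬ MinimalPt f x} ∧
    Dense {x : X | MinimalPt f x ∧ ¬ RegRecPt f x} := by
  have key : ∀ U : Set X, IsOpen U → U.Nonempty →
      ∃ m > 0, ∃ D : Bool → Set X, IsHorseshoe f^[m] D ∧ ∀ c, D c ⊆ U := by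
    intro U hU hne
    obtain ⟨u, huU, hu⟩ := hdense.inter_open_nonempty U hU hne
    exact exists_isHorseshoe hf hnw hsh hu (hU.mem_nhds huU)
  constructor <;> refine dense_iff_inter_open.2 fun U hU hne => ?_ <;>
    obtain ⟨m, hm, D, hD, hDU⟩ := key U hU hne
  · obtain ⟨c, x, hx, h⟩ := hD.exists_recurrentPt_not_minimalPt hf hm
    exact ⟨x, hDU c hx, h⟩
  · obtain ⟨c, x, hx, h⟩ := hD.exists_minimalPt_not_regRecPt hf hm
    exact ⟨x, hDU c hx, h⟩
end

section
/- Let (X,f) be a dynamical system with the shadowing property. Then (X,f) has positive topological entropy if and only if there exists a positive integer m, a closed f^m-invariant subset Y of X, and a factor map π : (Y, f^m) → ({0,1}^ℕ, σ) onto the full shift. -/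
open Set Function

variable {X : Type*}

open Dynamics Filter Topology Uniformity UniformSpace ENNReal

section PolynomialGrowth

open ExpGrowth

lemma eventually_nat_succ_pow_le_exp (K : ℕ) {r : ℝ} (hr : 0 < r) :
    ∀ᶠ n : ℕ in atTop, ((n : ℝ) + 1) ^ K ≤ Real.exp (r * n) := by
  have h := (isLittleO_pow_exp_pos_mul_atTop K hr).bound (Real.exp_pos (-r))
  have htend : Tendsto (fun n : ℕ => (n : ℝ) + 1) atTop atTop :=
    tendsto_atTop_add_const_right _ _ tendsto_natCast_atTop_atTop
  filter_upwards [htend.eventually h] with n hn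
  rw [Real.norm_of_nonneg (by positivity), Real.norm_of_nonneg (Real.exp_pos _).le,
    ← Real.exp_add] at hn
  exact hn.trans_eq (congrArg Real.exp (by ring))

lemma expGrowthSup_nat_succ_pow_le (K : ℕ) :
    expGrowthSup (fun n : ℕ => ((n : ℝ≥0∞) + 1) ^ K) ≤ 0 := by
  refine expGrowthSup_le_iff.2 fun b hb => ?_
  obtain ⟨r, hr, hrb⟩ := EReal.lt_iff_exists_real_btwn.1 hb
  filter_upwards [eventually_nat_succ_pow_le_exp K (EReal.coe_pos.1 hr)] with n hn
  calc ((n : ℝ≥0∞) + 1) ^ K = ENNReal.ofReal (((n : ℝ) + 1) ^ K) := by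
        rw [ENNReal.ofReal_pow (by positivity), ENNReal.ofReal_add (by positivity) zero_le_one]
        simp
    _ ≤ ENNReal.ofReal (Real.exp (r * n)) := ENNReal.ofReal_le_ofReal hn
    _ = EReal.exp ((r : EReal) * n) := by
        rw [← EReal.exp_coe, EReal.coe_mul]; rfl
    _ ≤ EReal.exp (b * n) := by gcongr

end PolynomialGrowth

section Itinerary

open scoped Classical

variable {ι : Type*} (f : X → X) (c : X → ι)

/-- First time at which the orbit of `x` visits the cell `a`, capped at `n`. -/
noncomputable def firstVisit (n : ℕ) (x : X) (a : ι) : ℕ :=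
  Nat.find (p := fun k => k = n ∨ c (f^[k] x) = a) ⟨n, Or.inl rfl⟩

/-- Last time before or at `n` at which the orbit of `x` visits the cell `a`, or `0`. -/
noncomputable def lastVisit (n : ℕ) (x : X) (a : ι) : ℕ :=
  Nat.findGreatest (fun k => c (f^[k] x) = a) n

variable {f c}

lemma firstVisit_le_bound (n : ℕ) (x : X) (a : ι) : firstVisit f c n x a ≤ n :=
  Nat.find_min' _ (Or.inl rfl)

lemma lastVisit_le_bound (n : ℕ) (x : X) (a : ι) : lastVisit f c n x a ≤ n :=
  Nat.findGreatest_le n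

lemma firstVisit_le {n i : ℕ} (x : X) : firstVisit f c n x (c (f^[i] x)) ≤ i :=
  Nat.find_min' _ (Or.inr rfl)

lemma le_lastVisit {n i : ℕ} (hi : i ≤ n) (x : X) : i ≤ lastVisit f c n x (c (f^[i] x)) :=
  Nat.le_findGreatest hi rfl

lemma apply_firstVisit {n : ℕ} {x : X} {a : ι} (h : firstVisit f c n x a < n) :
    c (f^[firstVisit f c n x a] x) = a :=
  (Nat.find_spec (p := fun k => k = n ∨ c (f^[k] x) = a) ⟨n, Or.inl rfl⟩).resolve_left h.ne

lemma apply_lastVisit {n k : ℕ} {x : X} {a : ι} (hk : k ≤ n) (h : c (f^[k] x) = a) :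
    c (f^[lastVisit f c n x a] x) = a :=
  Nat.findGreatest_spec (P := fun k => c (f^[k] x) = a) hk h

/-- Two orbits with the same first and last visit times visit, around any time `i`, a common cell
at two common times. -/
lemma exists_common_visits {n i : ℕ} {x y : X} (hi : i < n)
    (hF : firstVisit f c n x = firstVisit f c n y) (hL : lastVisit f c n x = lastVisit f c n y) :
    ∃ t s : ℕ, t ≤ i ∧ i ≤ s ∧ c (f^[t] x) = c (f^[s] x) ∧
      c (f^[t] y) = c (f^[t] x) ∧ c (f^[s] y) = c (f^[s] x) := by
  set a := c (f^[i] x) with ha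
  have hFx : firstVisit f c n x a ≤ i := firstVisit_le x
  have hx : c (f^[firstVisit f c n x a] x) = a := apply_firstVisit (hFx.trans_lt hi)
  have hy : c (f^[firstVisit f c n x a] y) = a := by
    rw [hF]; exact apply_firstVisit (hF ▸ hFx.trans_lt hi)
  have hx' : c (f^[lastVisit f c n x a] x) = a := apply_lastVisit hi.le rfl
  have hy' : c (f^[lastVisit f c n x a] y) = a := by
    rw [hL]; exact apply_lastVisit (hFx.trans hi.le) hy
  exact ⟨_, _, hFx, le_lastVisit hi.le x, hx.trans hx'.symm, hy.trans hx.symm, hy'.trans hx'.symm⟩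

/-- Two points of a large enough finite set have the same first and last visit times up to `n`. -/
lemma exists_same_visits [Fintype ι] {n : ℕ} {s : Finset X}
    (hs : (n + 1) ^ (2 * Fintype.card ι) < s.card) :
    ∃ x ∈ s, ∃ y ∈ s, x ≠ y ∧ firstVisit f c n x = firstVisit f c n y ∧
      lastVisit f c n x = lastVisit f c n y := by
  let D : X → ι → Fin (n + 1) × Fin (n + 1) := fun x a =>
    (⟨firstVisit f c n x a, Nat.lt_succ_of_le (firstVisit_le_bound n x a)⟩,
      ⟨lastVisit f c n x a, Nat.lt_succ_of_le (lastVisit_le_bound n x a)⟩)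
  obtain ⟨x, hx, y, hy, hxy, h⟩ := Finset.exists_ne_map_eq_of_card_lt_of_maps_to
    (s := s) (t := Finset.univ) (f := D)
    (by
      rw [Finset.card_univ, Fintype.card_fun, Fintype.card_prod, Fintype.card_fin, ← sq, ← pow_mul]
      exact hs)
    (fun x _ => Finset.mem_univ _)
  refine ⟨x, hx, y, hy, hxy, ?_, ?_⟩ <;> funext a <;> have := congrFun h a <;>
    simp only [D, Prod.mk.injEq, Fin.mk.injEq] at this
  exacts [this.1, this.2]

end Itinerary

lemma exists_finite_cells [MetricSpace X] [CompactSpace X] {δ : ℝ} (hδ : 0 < δ) :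
    ∃ (t : Finset X) (c : X → t), ∀ x y, c x = c y → dist x y < δ := by
  obtain ⟨t, ht, hcov⟩ := Metric.totallyBounded_iff.1
    (isCompact_univ (X := X)).totallyBounded (δ / 2) (half_pos hδ)
  have hc : ∀ x : X, ∃ a : ht.toFinset, dist x a < δ / 2 := fun x => by
    obtain ⟨a, ha, hxa⟩ := mem_iUnion₂.1 (hcov (mem_univ x))
    exact ⟨⟨a, ht.mem_toFinset.2 ha⟩, hxa⟩
  choose cell hc using hc
  refine ⟨ht.toFinset, cell, fun x y hxy => ?_⟩
  have hx := hc x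
  have hy := hc y
  rw [← hxy] at hy
  linarith [dist_triangle_right x y (cell x : X)]

lemma exists_large_net (f : X → X) {F : Set X} {U : SetRel X X}
    (h : 0 < netEntropyEntourage f F U) (K : ℕ) :
    ∃ (n : ℕ) (s : Finset X), IsDynNetIn f F U n s ∧ (n + 1) ^ K < s.card := by
  by_contra! hcon
  refine h.not_ge (le_trans (ExpGrowth.expGrowthSup_monotone fun n => ?_)
    (expGrowthSup_nat_succ_pow_le K))
  have : netMaxcard f F U n ≤ (((n + 1) ^ K : ℕ) : ℕ∞) :=
    iSup₂_le fun s hs => Nat.cast_le.2 (hcon n s hs)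
  simpa using ENat.toENNReal_mono this

/-- In a system of positive entropy there are, for some `ε > 0` and every `δ > 0`, two
`δ`-loops of the same length at the same place that are `ε`-apart at some time. -/
lemma exists_separated_loops [MetricSpace X] [CompactSpace X] {f : X → X}
    (h : 0 < coverEntropy f univ) :
    ∃ ε > (0 : ℝ), ∀ δ > (0 : ℝ), ∃ (m j : ℕ) (x y : X), j < m ∧
      ε ≤ dist (f^[j] x) (f^[j] y) ∧
      dist (f^[m] x) x < δ ∧ dist (f^[m] x) y < δ ∧
      dist (f^[m] y) x < δ ∧ dist (f^[m] y) y < δ := by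
  rw [coverEntropy_eq_iSup_basis_netEntropyEntourage Metric.uniformity_basis_dist] at h
  obtain ⟨ε, h⟩ := lt_iSup_iff.1 h
  obtain ⟨hε, h⟩ := lt_iSup_iff.1 h
  refine ⟨ε, hε, fun δ hδ => ?_⟩
  obtain ⟨t, c, hc⟩ := exists_finite_cells (X := X) (lt_min hδ hε)
  obtain ⟨n, s, hnet, hcard⟩ := exists_large_net f h (2 * Fintype.card t)
  obtain ⟨x, hx, y, hy, hxy, hF, hL⟩ := exists_same_visits (f := f) (c := c) hcard
  obtain ⟨i, hin, hsep⟩ : ∃ i < n, ε ≤ dist (f^[i] x) (f^[i] y) := by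
    by_contra! hclose
    refine Set.disjoint_left.1 (hnet.2 hx hy hxy) (?_ : y ∈ _) ?_ <;>
      refine mem_ball_dynEntourage.2 fun k hk => ?_
    · exact hclose k hk
    · exact refl_mem_uniformity (Metric.dist_mem_uniformity hε)
  obtain ⟨a, b, hai, hib, hab, ha, hb⟩ := exists_common_visits hin hF hL
  have hib' : i < b := hib.lt_of_ne fun hib' => by
    subst hib'
    exact (((hc _ _ hb.symm).trans_le (min_le_right _ _)).not_ge hsep).elim
  have hm : ∀ z, f^[b - a] (f^[a] z) = f^[b] z := fun z => by
    rw [← iterate_add_apply, Nat.sub_add_cancel (hai.trans hib)]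
  have hcell : ∀ p q, c p = c q → dist p q < δ := fun p q h =>
    (hc p q h).trans_le (min_le_left _ _)
  refine ⟨b - a, i - a, f^[a] x, f^[a] y, by omega, ?_, ?_, ?_, ?_, ?_⟩
  · rwa [← iterate_add_apply, ← iterate_add_apply, Nat.sub_add_cancel hai]
  all_goals rw [hm]; apply hcell
  · exact hab.symm
  · exact (ha.trans hab).symm
  · exact hb.trans hab.symm
  · exact hb.trans (ha.trans hab).symm

section Horseshoe

/-- The concatenation of the orbit segments of length `m` of `x` and `y` prescribed by `ω`. -/
def loopConcat (f : X → X) (m : ℕ) (x y : X) (ω : ℕ → Fin 2) (n : ℕ) : X :=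
  f^[n % m] (if ω (n / m) = 0 then x else y)

lemma loopConcat_add (f : X → X) {m : ℕ} (hm : 0 < m) (x y : X) (ω : ℕ → Fin 2) (n : ℕ) :
    loopConcat f m x y ω (n + m) = loopConcat f m x y (shiftMap 2 ω) n := by
  rw [loopConcat, Nat.add_mod_right, Nat.add_div_right _ hm]
  rfl

variable [MetricSpace X] {f : X → X}

lemma continuous_loopConcat (m : ℕ) (x y : X) (n : ℕ) :
    Continuous fun ω => loopConcat f m x y ω n :=
  (continuous_of_discreteTopology (f := fun b : Fin 2 => f^[n % m] (if b = 0 then x else y))).comp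
    (continuous_apply (n / m))

lemma isPseudoOrbit_loopConcat {m : ℕ} (hm : 0 < m) {δ : ℝ} (hδ : 0 < δ) {x y : X}
    (hxx : dist (f^[m] x) x < δ) (hxy : dist (f^[m] x) y < δ) (hyx : dist (f^[m] y) x < δ)
    (hyy : dist (f^[m] y) y < δ) (ω : ℕ → Fin 2) :
    IsPseudoOrbit f δ (loopConcat f m x y ω) := by
  intro n
  have hlt := Nat.mod_lt n hm
  rw [loopConcat, ← iterate_succ_apply' f]
  rcases (Nat.succ_le_of_lt hlt).eq_or_lt with h | h
  · have hmod : (n + 1) % m = 0 := by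
      rw [← Nat.mod_add_mod, ← Nat.succ_eq_add_one, h, Nat.mod_self]
    rw [loopConcat, hmod, h]
    simp only [iterate_zero, id]
    split_ifs <;> assumption
  · have hmod : (n + 1) % m = n % m + 1 := by
      rw [← Nat.mod_add_mod]
      exact Nat.mod_eq_of_lt h
    have hdiv : (n + 1) / m = n / m := by
      rw [Nat.succ_div_of_mod_ne_zero (by omega)]
    rw [loopConcat, hmod, hdiv, dist_self]
    exact hδ

theorem exists_factorOntoShift_of_loops [CompactSpace X] (hf : Continuous f) {ε : ℝ} (hε : 0 < ε)
    {m j : ℕ} (hj : j < m) {x y : X} (hsep : ε ≤ dist (f^[j] x) (f^[j] y))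
    (htr : ∀ ω, ∃ z, Traces f (ε / 3) z (loopConcat f m x y ω)) :
    ∃ Y : Set X, IsClosed Y ∧ MapsTo f^[m] Y Y ∧
      ∃ π : X → (ℕ → Fin 2), FactorOntoShift f m Y 2 π := by
  classical
  have hm : 0 < m := j.zero_le.trans_lt hj
  set T : (ℕ → Fin 2) → X → Prop := fun ω z =>
    ∀ n, dist (f^[n] z) (loopConcat f m x y ω n) ≤ ε / 3 with hT
  have hT_shift : ∀ {ω z}, T ω z → T (shiftMap 2 ω) (f^[m] z) := by
    intro ω z h n
    rw [← iterate_add_apply, ← loopConcat_add f hm]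
    exact h (n + m)
  have hT_time : ∀ {ω z}, T ω z → ∀ k,
      dist (f^[m * k + j] z) (f^[j] (if ω k = 0 then x else y)) ≤ ε / 3 := by
    intro ω z h k
    have := h (m * k + j)
    rwa [loopConcat, Nat.mul_add_mod, Nat.mod_eq_of_lt hj, Nat.mul_add_div hm,
      Nat.div_eq_of_lt hj, add_zero] at this
  let π : X → ℕ → Fin 2 := fun z k => if dist (f^[m * k + j] z) (f^[j] x) < ε / 2 then 0 else 1
  have hfar : ∀ {ω z k}, T ω z → ω k ≠ 0 → ε / 2 < dist (f^[m * k + j] z) (f^[j] x) := by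
    intro ω z k h hk
    have h1 := hT_time h k
    rw [if_neg hk] at h1
    have h2 := dist_triangle_left (f^[j] x) (f^[j] y) (f^[m * k + j] z)
    linarith
  have hnear : ∀ {ω z k}, T ω z → ω k = 0 → dist (f^[m * k + j] z) (f^[j] x) < ε / 2 := by
    intro ω z k h hk
    have h1 := hT_time h k
    rw [if_pos hk] at h1
    linarith
  have hπ : ∀ {ω z}, T ω z → π z = ω := by
    intro ω z h
    funext k
    by_cases hk : ω k = 0
    · simp only [π, if_pos (hnear h hk), hk]
    · simp only [π, if_neg (hfar h hk).not_gt]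
      omega
  have hcont : ∀ k, Continuous fun z => dist (f^[m * k + j] z) (f^[j] x) :=
    fun k => (hf.iterate _).dist continuous_const
  refine ⟨{z | ∃ ω, T ω z}, ?_, fun z ⟨ω, h⟩ => ⟨_, hT_shift h⟩, π, ?_, ?_, ?_⟩
  · have hclosed : IsClosed {p : (ℕ → Fin 2) × X | T p.1 p.2} := by
      simp only [hT, ofPred_forall]
      exact isClosed_iInter fun n => isClosed_le
        (((hf.iterate n).comp continuous_snd).dist
          ((continuous_loopConcat m x y n).comp continuous_fst)) continuous_const
    convert isClosedMap_snd_of_compactSpace _ hclosed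
    ext z
    simp
  · refine continuousOn_pi.2 fun k z ⟨ω, h⟩ => ?_
    refine tendsto_const_nhds.congr' ?_
    by_cases hk : ω k = 0
    · filter_upwards [mem_nhdsWithin_of_mem_nhds
        ((hcont k).continuousAt.eventually_lt continuousAt_const (hnear h hk))] with w hw
      simp only [π, if_pos hw, if_pos (hnear h hk)]
    · filter_upwards [mem_nhdsWithin_of_mem_nhds
        (continuousAt_const.eventually_lt (hcont k).continuousAt (hfar h hk))] with w hw
      simp only [π, if_neg hw.not_gt, if_neg (hfar h hk).not_gt]
  · refine eq_univ_of_forall fun ω => ?_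
    obtain ⟨z, hz⟩ := htr ω
    have h : T ω z := fun n => (hz n).le
    exact ⟨z, ⟨ω, h⟩, hπ h⟩
  · rintro z ⟨ω, h⟩
    rw [hπ h, hπ (hT_shift h)]

end Horseshoe

section FactorEntropy

variable [MetricSpace X] {f : X → X} {m : ℕ} {Y : Set X} {π : X → ℕ → Fin 2}

lemma FactorOntoShift.apply_iterate (h : FactorOntoShift f m Y 2 π) (hY : MapsTo f^[m] Y Y)
    {y : X} (hy : y ∈ Y) (k : ℕ) : π (f^[m * k] y) 0 = π y k := by
  induction k generalizing y with
  | zero => simp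
  | succ k ih =>
    rw [Nat.mul_succ, iterate_add_apply, ih (hY hy), h.2.2 y hy, shiftMap]

variable [CompactSpace X]

lemma FactorOntoShift.two_pow_le_netMaxcard (h : FactorOntoShift f m Y 2 π) (hm : 0 < m)
    (hYc : IsClosed Y) (hY : MapsTo f^[m] Y Y) :
    ∃ U ∈ 𝓤 X, ∀ n, (2 : ℕ∞) ^ n ≤ netMaxcard f univ U (m * n) := by
  classical
  obtain ⟨V, hV, hVπ⟩ : ∃ V ∈ 𝓤 X, ∀ a ∈ Y, ∀ b ∈ Y, (a, b) ∈ V → π a 0 = π b 0 := by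
    have hc : ContinuousOn (fun z => ((π z 0 : ℕ) : ℝ)) Y :=
      (continuous_of_discreteTopology (f := fun b : Fin 2 => ((b : ℕ) : ℝ))).comp_continuousOn
        ((continuous_apply 0).comp_continuousOn h.1)
    obtain ⟨r, hr, hclose⟩ := Metric.uniformContinuousOn_iff.1
      (hYc.isCompact.uniformContinuousOn_of_continuous hc) 1 one_pos
    refine ⟨_, Metric.dist_mem_uniformity hr, fun a ha b hb hab => Fin.ext ?_⟩
    have := hclose a ha b hb hab
    rw [Nat.dist_cast_real] at this
    exact not_ne_iff.1 fun hne => (Nat.pairwise_one_le_dist hne).not_gt this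
  obtain ⟨U, hU, hUsymm, hUV⟩ := comp_symm_mem_uniformity_sets hV
  refine ⟨U, hU, fun n => ?_⟩
  have hsurj : ∀ w : Fin n → Fin 2, ∃ y ∈ Y, ∀ i : Fin n, π y i = w i := by
    intro w
    obtain ⟨y, hy, hyw⟩ := h.2.1.ge
      (mem_univ fun k => if hk : k < n then w ⟨k, hk⟩ else 0)
    exact ⟨y, hy, fun i => by simp [hyw]⟩
  choose y hyY hyw using hsurj
  have hclose : ∀ v w, (ball (y v) (dynEntourage f U (m * n)) ∩
      ball (y w) (dynEntourage f U (m * n))).Nonempty → v = w := by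
    rintro v w ⟨z, hzv, hzw⟩
    funext i
    rw [← hyw v i, ← hyw w i, ← h.apply_iterate hY (hyY v), ← h.apply_iterate hY (hyY w)]
    have hi : m * i < m * n := Nat.mul_lt_mul_of_pos_left i.2 hm
    have hit : ∀ u, f^[m * (i : ℕ)] (y u) ∈ Y := fun u => by
      rw [iterate_mul]; exact hY.iterate i (hyY u)
    exact hVπ _ (hit v) _ (hit w) (hUV ⟨f^[m * (i : ℕ)] z, mem_ball_dynEntourage.1 hzv _ hi,
      hUsymm.symm _ _ (mem_ball_dynEntourage.1 hzw _ hi)⟩)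
  have hinj : Injective y := by
    intro v w hvw
    refine hclose v w ⟨y v, ?_, ?_⟩
    · exact mem_ball_dynEntourage.2 fun k _ => refl_mem_uniformity hU
    · rw [hvw]; exact mem_ball_dynEntourage.2 fun k _ => refl_mem_uniformity hU
  have hnet : IsDynNetIn f univ U (m * n) (Finset.univ.image y : Finset X) := by
    refine ⟨subset_univ _, ?_⟩
    simp only [Finset.coe_image, Finset.coe_univ, image_univ]
    rintro _ ⟨v, rfl⟩ _ ⟨w, rfl⟩ hvw
    refine Set.disjoint_iff_inter_eq_empty.2 (not_nonempty_iff_eq_empty.1 fun hne => hvw ?_)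
    rw [hclose v w hne]
  have := hnet.card_le_netMaxcard
  rw [Finset.card_image_of_injective _ hinj] at this
  simpa using this

theorem FactorOntoShift.coverEntropy_pos (h : FactorOntoShift f m Y 2 π) (hm : 0 < m)
    (hYc : IsClosed Y) (hY : MapsTo f^[m] Y Y) : 0 < coverEntropy f univ := by
  obtain ⟨U, hU, hcard⟩ := h.two_pow_le_netMaxcard hm hYc hY
  refine lt_of_lt_of_le ?_ (netEntropyEntourage_le_coverEntropy f univ hU)
  by_contra! hle
  have hmono : Monotone fun n => (netMaxcard f univ U n : ℝ≥0∞) :=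
    fun _ _ hkl => ENat.toENNReal_mono (netMaxcard_monotone_time f univ U hkl)
  have h1 : ExpGrowth.expGrowthSup (fun n => (2 : ℝ≥0∞) ^ n) ≤
      ExpGrowth.expGrowthSup fun n => (netMaxcard f univ U (m * n) : ℝ≥0∞) :=
    ExpGrowth.expGrowthSup_monotone fun n => by
      simpa using ENat.toENNReal_mono (hcard n)
  rw [ExpGrowth.expGrowthSup_pow, hmono.expGrowthSup_comp_mul hm.ne'] at h1
  have h2 : (m : EReal) * netEntropyEntourage f univ U ≤ 0 :=
    mul_nonpos_of_nonneg_of_nonpos (by positivity) hle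
  exact (ENNReal.zero_lt_log_iff.2 one_lt_two).not_ge (h1.trans h2)

end FactorEntropy

theorem positive_entropy_iff_shift_factor [MetricSpace X] [CompactSpace X]
    (f : X → X) (hf : Continuous f) (hsh : HasShadowing f) :
    0 < Dynamics.coverEntropy f Set.univ ↔
      ∃ m : ℕ, 1 ≤ m ∧ ∃ Y : Set X, IsClosed Y ∧ Set.MapsTo f^[m] Y Y ∧
        ∃ π : X → (ℕ → Fin 2), FactorOntoShift f m Y 2 π := by
  refine ⟨fun h => ?_, fun ⟨m, hm, Y, hYc, hY, π, hπ⟩ => hπ.coverEntropy_pos hm hYc hY⟩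
  obtain ⟨ε, hε, hloops⟩ := exists_separated_loops h
  obtain ⟨δ, hδ, hsh⟩ := hsh (ε / 3) (by positivity)
  obtain ⟨m, j, x, y, hj, hsep, hxx, hxy, hyx, hyy⟩ := hloops δ hδ
  have hm : 0 < m := j.zero_le.trans_lt hj
  exact ⟨m, hm, exists_factorOntoShift_of_loops hf hε hj hsep fun ω =>
    hsh _ (isPseudoOrbit_loopConcat hm hδ hxx hxy hyx hyy ω)⟩
end

section
/- Let (X,f) be a weakly mixing dynamical system with the shadowing property. Then the set of ergodic f-invariant Borel probability measures whose support equals the orbit closure of a regularly recurrent point is dense in the space M_f(X) of all f-invariant Borel probability measures, with respect to the weak-* topology. -/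
open Set Function

variable {X : Type*}

/-- The support of a measure: points all of whose neighborhoods have positive measure. -/
def measSupport [TopologicalSpace X] [MeasurableSpace X]
    (μ : MeasureTheory.Measure X) : Set X :=
  {x : X | ∀ U ∈ nhds x, 0 < μ U}

namespace RegRecDensity

/-- `q` restricted to `{0, …, n}` is a `δ`-pseudo-orbit segment of `f` from `a` to `b`. -/
def IsPseudoSegment [MetricSpace X] (f : X → X) (δ : ℝ) (n : ℕ) (a b : X) (q : ℕ → X) : Prop :=
  q 0 = a ∧ q n = b ∧ ∀ i < n, dist (f (q i)) (q (i + 1)) < δ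

theorem TopTransitive.of_weaklyMixing [TopologicalSpace X] {f : X → X} (h : WeaklyMixing f) :
    TopTransitive f := by
  intro U V hU hUn hV hVn
  obtain ⟨n, hn, p, ⟨u, hu, rfl⟩, hp⟩ :=
    h (U ×ˢ U) (V ×ˢ V) (hU.prod hU) (hUn.prod hUn) (hV.prod hV) (hVn.prod hVn)
  have key : ∀ (k : ℕ) (w : X × X),
      ((fun p : X × X => (f p.1, f p.2))^[k] w).1 = f^[k] w.1 := by
    intro k
    induction k with
    | zero => intro w; rfl
    | succ k ih => intro w; rw [iterate_succ_apply, iterate_succ_apply, ih]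
  refine ⟨n, hn, f^[n] u.1, ⟨u.1, hu.1, rfl⟩, ?_⟩
  rw [← key]
  exact hp.1

/-- In a compact transitive system any two points are joined by pseudo-orbit segments of bounded
length. -/
theorem exists_isPseudoSegment_of_topTransitive [MetricSpace X] [CompactSpace X] {f : X → X}
    (htr : TopTransitive f) {δ : ℝ} (hδ : 0 < δ) :
    ∃ L : ℕ, ∀ a b : X, ∃ n ≤ L, ∃ q : ℕ → X, IsPseudoSegment f δ n a b q := by
  obtain ⟨t, -, ht, hcov⟩ :=
    finite_cover_balls_of_compact (isCompact_univ (X := X)) (half_pos hδ)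
  have htr' : ∀ c d : X, ∃ (k : ℕ) (u : X), 1 ≤ k ∧ dist u c < δ / 2 ∧
      dist (f^[k] u) d < δ / 2 := by
    intro c d
    obtain ⟨k, hk, v, ⟨u, hu, rfl⟩, hv⟩ := htr (Metric.ball c (δ / 2)) (Metric.ball d (δ / 2))
      Metric.isOpen_ball ⟨c, Metric.mem_ball_self (half_pos hδ)⟩
      Metric.isOpen_ball ⟨d, Metric.mem_ball_self (half_pos hδ)⟩
    exact ⟨k, u, hk, hu, hv⟩
  choose k u hk hu hku using htr'
  obtain ⟨L, hL⟩ := ((ht.prod ht).image (fun p : X × X => k p.1 p.2)).bddAbove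
  refine ⟨L + 1, fun a b => ?_⟩
  obtain ⟨c, hc, hac⟩ : ∃ c ∈ t, dist (f a) c < δ / 2 := by
    simpa using hcov (mem_univ (f a))
  obtain ⟨d, hd, hbd⟩ : ∃ d ∈ t, dist b d < δ / 2 := by
    simpa using hcov (mem_univ b)
  have hkL : k c d ≤ L := hL ⟨(c, d), ⟨hc, hd⟩, rfl⟩
  have h1 := hk c d
  refine ⟨k c d + 1, by omega,
    fun i => if i = 0 then a else if i = k c d + 1 then b else f^[i - 1] (u c d),
    by simp, by simp, ?_⟩
  intro i hi
  have hfu : dist (f a) (u c d) < δ := by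
    have := dist_triangle_right (f a) (u c d) c
    have := hu c d
    linarith
  have hfb : dist (f^[k c d] (u c d)) b < δ := by
    have := dist_triangle_right (f^[k c d] (u c d)) b d
    have := hku c d
    linarith
  rcases Nat.eq_zero_or_pos i with rfl | hi0
  · have : k c d ≠ 0 := by omega
    simpa [this, this.symm] using hfu
  · obtain ⟨j, rfl⟩ : ∃ j, i = j + 1 := ⟨i - 1, by omega⟩
    by_cases hj : j + 1 = k c d
    · rw [← hj, iterate_succ_apply'] at hfb
      simpa [← hj] using hfb
    · have h2 : j ≠ k c d := by omega
      simp [hj, h2, ← iterate_succ_apply' f, hδ]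

theorem IsPseudoSegment.append [MetricSpace X] {f : X → X} {δ : ℝ} {n m : ℕ} {a b c : X}
    {p q : ℕ → X} (hp : IsPseudoSegment f δ n a b p) (hq : IsPseudoSegment f δ m b c q) :
    ∃ r : ℕ → X, IsPseudoSegment f δ (n + m) a c r ∧ ∀ φ : X → ℝ,
      ∑ i ∈ Finset.range (n + m), φ (r i) =
        ∑ i ∈ Finset.range n, φ (p i) + ∑ i ∈ Finset.range m, φ (q i) := by
  obtain ⟨hp0, hpn, hp⟩ := hp
  obtain ⟨hq0, hqm, hq⟩ := hq
  refine ⟨fun i => if i < n then p i else q (i - n), ⟨?_, by simp [hqm], ?_⟩, ?_⟩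
  · rcases Nat.eq_zero_or_pos n with rfl | hn
    · simp [hq0, ← hpn, hp0]
    · simp [hn, hp0]
  · intro i hi
    rcases lt_trichotomy (i + 1) n with h | h | h
    · simpa [h, (by omega : i < n)] using hp i (by omega)
    · have := hp i (by omega)
      rw [h, hpn, ← hq0] at this
      simpa [h, (by omega : i < n)] using this
    · have := hq (i - n) (by omega)
      rw [show i - n + 1 = i + 1 - n by omega] at this
      simpa only [if_neg (by omega : ¬ i < n), if_neg (by omega : ¬ i + 1 < n)] using this
  · intro φ
    rw [Finset.sum_range_add]
    congr 1
    · exact Finset.sum_congr rfl fun i hi => by simp [Finset.mem_range.1 hi]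
    · simp

/-- Orbit segments of length `N` can be concatenated into a pseudo-orbit segment, with gaps of
length at most `L`. -/
theorem exists_isPseudoSegment_through [MetricSpace X] {f : X → X} {δ : ℝ} (hδ : 0 < δ) {L : ℕ}
    (hL : ∀ a b : X, ∃ n ≤ L, ∃ q : ℕ → X, IsPseudoSegment f δ n a b q) (N : ℕ) (x : ℕ → X)
    (m : ℕ) :
    ∃ (n : ℕ) (q : ℕ → X), IsPseudoSegment f δ n (x 0) (x m) q ∧ m * N ≤ n ∧ n ≤ m * (N + L) ∧
      ∀ (φ : X → ℝ) (C : ℝ), (∀ y, |φ y| ≤ C) →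
        |∑ i ∈ Finset.range n, φ (q i) - ∑ j ∈ Finset.range m, birkhoffSum f φ N (x j)|
          ≤ m * L * C := by
  induction m with
  | zero => exact ⟨0, fun _ => x 0, ⟨rfl, rfl, by simp⟩, by simp, by simp, by simp⟩
  | succ m ih =>
    obtain ⟨n, q, hq, hn, hn', hφ⟩ := ih
    have horb : IsPseudoSegment f δ N (x m) (f^[N] (x m)) (fun i => f^[i] (x m)) :=
      ⟨rfl, rfl, fun i _ => by simpa [← iterate_succ_apply' f] using hδ⟩
    obtain ⟨k, hk, g, hg⟩ := hL (f^[N] (x m)) (x (m + 1))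
    obtain ⟨r, hr, hrφ⟩ := hq.append horb
    obtain ⟨r', hr', hrφ'⟩ := hr.append hg
    refine ⟨n + N + k, r', hr', by linarith, by nlinarith, fun φ C hC => ?_⟩
    have hgap : |∑ i ∈ Finset.range k, φ (g i)| ≤ L * C := by
      have hC0 : 0 ≤ C := (abs_nonneg _).trans (hC (x 0))
      calc |∑ i ∈ Finset.range k, φ (g i)| ≤ ∑ i ∈ Finset.range k, |φ (g i)| :=
            Finset.abs_sum_le_sum_abs _ _
        _ ≤ ∑ i ∈ Finset.range k, C := Finset.sum_le_sum fun i _ => hC _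
        _ = k * C := by simp
        _ ≤ L * C := by gcongr
    have h := hφ φ C hC
    rw [hrφ', hrφ, Finset.sum_range_succ]
    rw [show birkhoffSum f φ N (x m) = ∑ i ∈ Finset.range N, φ (f^[i] (x m)) from rfl]
    rw [abs_le] at *
    push_cast
    constructor <;> linarith [h.1, h.2, hgap.1, hgap.2]

/-- A periodic pseudo-orbit is traced by a point returning close to itself at a multiple of the
period. -/
theorem exists_traces_dist_iterate_lt [MetricSpace X] [CompactSpace X] {f : X → X} {ε : ℝ}
    {q : ℕ → X} (hq : ∃ z, Traces f ε z q) {P : ℕ} (hP : 1 ≤ P) (hper : Periodic q P)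
    {δ : ℝ} (hδ : 0 < δ) :
    ∃ (y : X) (P' : ℕ), 1 ≤ P' ∧ P ∣ P' ∧ Traces f ε y q ∧ dist (f^[P'] y) y < δ := by
  obtain ⟨y₀, hy₀⟩ := hq
  obtain ⟨a, g, hg, ha⟩ := CompactSpace.tendsto_subseq fun j : ℕ => f^[j * P] y₀
  obtain ⟨n, hn⟩ := Metric.tendsto_atTop.1 ha (δ / 2) (half_pos hδ)
  have h1 := hn n le_rfl
  have h2 := hn (n + 1) n.le_succ
  have hlt : g n < g (n + 1) := hg n.lt_succ_self
  refine ⟨f^[g n * P] y₀, (g (n + 1) - g n) * P, Nat.mul_pos (by omega) hP, dvd_mul_left _ _,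
    fun t => ?_, ?_⟩
  · rw [← iterate_add_apply, ← (hper.nat_mul (g n)) t]
    exact hy₀ _
  · rw [← iterate_add_apply, ← Nat.add_mul, Nat.sub_add_cancel hlt.le]
    have := dist_triangle_right (f^[g (n + 1) * P] y₀) (f^[g n * P] y₀) a
    simp only [comp_apply] at h1 h2
    linarith

theorem isPseudoOrbit_mod [MetricSpace X] {f : X → X} {δ : ℝ} {P : ℕ} (hP : 1 ≤ P) {a : X}
    {q : ℕ → X} (hq : IsPseudoSegment f δ P a a q) :
    IsPseudoOrbit f δ (fun t => q (t % P)) := by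
  intro t
  have hlt : t % P < P := Nat.mod_lt _ hP
  have h := hq.2.2 _ hlt
  show dist (f (q (t % P))) (q ((t + 1) % P)) < δ
  rw [Nat.add_mod]
  by_cases h1 : t % P + 1 = P
  · rw [h1, hq.2.1, ← hq.1] at h
    rcases eq_or_ne P 1 with rfl | hP1
    · simpa [Nat.mod_one] using h
    · rw [Nat.mod_eq_of_lt (by omega : 1 < P), h1, Nat.mod_self]
      exact h
  · rwa [Nat.mod_eq_of_lt (by omega : 1 < P), Nat.mod_eq_of_lt (by omega : t % P + 1 < P)]

/-- With shadowing, periodic pseudo-orbits are traced by regularly recurrent points. -/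
theorem exists_regRecPt_tracing [MetricSpace X] [CompactSpace X] {f : X → X} (hf : Continuous f)
    (hsh : HasShadowing f) {ε : ℝ} (hε : 0 < ε) :
    ∃ δ > 0, ∀ (q : ℕ → X) (P : ℕ), IsPseudoOrbit f δ q → 1 ≤ P → Periodic q P →
      ∃ z, RegRecPt f z ∧ ∀ t, dist (f^[t] z) (q t) ≤ ε := by
  set e : ℕ → ℝ := fun n => ε / 4 / 2 ^ n with he
  have he0 : ∀ n, 0 < e n := fun n => by positivity
  choose D hD0 hD using fun n => hsh (e n) (he0 n)
  obtain ⟨δ, hδ, hδsh⟩ := hsh (ε / 2) (half_pos hε)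
  refine ⟨δ, hδ, fun q P hq hP hper => ?_⟩
  obtain ⟨y₀, P₀, hP₀, hPP₀, htr₀, hret₀⟩ :=
    exists_traces_dist_iterate_lt (hδsh q hq) hP hper (hD0 0)
  have step : ∀ (n : ℕ) (p : X × ℕ), 1 ≤ p.2 ∧ dist (f^[p.2] p.1) p.1 < D n →
      ∃ p' : X × ℕ, (1 ≤ p'.2 ∧ dist (f^[p'.2] p'.1) p'.1 < D (n + 1)) ∧ p.2 ∣ p'.2 ∧
        ∀ t, dist (f^[t] p'.1) (f^[t % p.2] p.1) < e n := by
    rintro n ⟨y, Q⟩ ⟨hQ, hyQ⟩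
    have hpos : IsPseudoOrbit f (D n) (fun t => update (fun i => f^[i] y) Q y (t % Q)) := by
      refine isPseudoOrbit_mod hQ (a := y) ⟨?_, by simp, fun i hi => ?_⟩
      · rw [update_of_ne (by omega)]; rfl
      · rw [update_of_ne (by omega)]
        by_cases h : i + 1 = Q
        · rw [h, update_self, ← iterate_succ_apply' f, Nat.succ_eq_add_one, h]
          exact hyQ
        · rw [update_of_ne h, ← iterate_succ_apply' f, dist_self]
          exact hD0 n
    have heq : (fun t => update (fun i => f^[i] y) Q y (t % Q)) = fun t => f^[t % Q] y := by
      funext t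
      rw [update_of_ne (Nat.mod_lt _ hQ).ne]
    rw [heq] at hpos
    obtain ⟨y', Q', h1, h2, h3, h4⟩ := exists_traces_dist_iterate_lt (hD n _ hpos) hQ
      (fun t => by simp) (hD0 (n + 1))
    exact ⟨(y', Q'), ⟨h1, h4⟩, h2, h3⟩
  choose! s hs using step
  let u : ℕ → X × ℕ := fun n => Nat.rec (y₀, P₀) (fun n p => s n p) n
  have hu : ∀ n, 1 ≤ (u n).2 ∧ dist (f^[(u n).2] (u n).1) (u n).1 < D n := by
    intro n
    induction n with
    | zero => exact ⟨hP₀, hret₀⟩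
    | succ n ih => exact (hs n _ ih).1
  have hdvd : ∀ n, (u n).2 ∣ (u (n + 1)).2 := fun n => (hs n _ (hu n)).2.1
  have hdist : ∀ n t, dist (f^[t] (u (n + 1)).1) (f^[t % (u n).2] (u n).1) < e n :=
    fun n => (hs n _ (hu n)).2.2
  have hdvd' : ∀ m k, (u m).2 ∣ (u (m + k)).2 := by
    intro m k
    induction k with
    | zero => exact dvd_rfl
    | succ k ih => exact ih.trans (hdvd _)
  have hclose : ∀ m k t, dist (f^[t] (u (m + 1 + k)).1) (f^[t % (u m).2] (u m).1)
      ≤ 2 * e m - 2 * e (m + 1 + k) := by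
    intro m k
    induction k with
    | zero =>
      intro t
      have h2 : 2 * e (m + 1 + 0) = e m := by
        simp only [he, add_zero, pow_succ]; field_simp
      have := hdist m t
      simp only [add_zero] at *
      linarith
    | succ k ih =>
      intro t
      have h1 := hdist (m + 1 + k) t
      have h2 := ih (t % (u (m + 1 + k)).2)
      rw [Nat.mod_mod_of_dvd _ (by rw [add_assoc]; exact hdvd' m (1 + k))] at h2
      have h3 : 2 * e (m + 1 + (k + 1)) = e (m + 1 + k) := by
        simp only [he, ← add_assoc, pow_succ]; field_simp
      have h4 := dist_triangle (f^[t] (u (m + 1 + (k + 1))).1)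
        (f^[t % (u (m + 1 + k)).2] (u (m + 1 + k)).1) (f^[t % (u m).2] (u m).1)
      rw [← add_assoc] at *
      linarith
  have hcau : CauchySeq fun n => (u n).1 := by
    refine cauchySeq_of_le_geometric_two (C := ε / 2) fun n => ?_
    have h := (hdist n 0).le
    simp only [Nat.zero_mod, iterate_zero, id] at h
    rw [dist_comm]
    refine h.trans (le_of_eq ?_)
    simp only [he]
    ring
  obtain ⟨z, hz⟩ := cauchySeq_tendsto_of_complete hcau
  have hztr : ∀ m t, dist (f^[t] z) (f^[t % (u m).2] (u m).1) ≤ 2 * e m := by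
    intro m t
    have hlim : Filter.Tendsto
        (fun n => dist (f^[t] (u n).1) (f^[t % (u m).2] (u m).1)) Filter.atTop
        (nhds (dist (f^[t] z) (f^[t % (u m).2] (u m).1))) :=
      (((hf.iterate t).tendsto z).comp hz).dist tendsto_const_nhds
    refine le_of_tendsto hlim (Filter.eventually_atTop.2 ⟨m + 1, fun n hn => ?_⟩)
    obtain ⟨k, rfl⟩ := Nat.exists_eq_add_of_le hn
    have := hclose m k t
    have := he0 (m + 1 + k)
    linarith
  refine ⟨z, fun U hU => ?_, fun t => ?_⟩
  · obtain ⟨r, hr, hrU⟩ := Metric.mem_nhds_iff.1 hU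
    obtain ⟨m, hm⟩ : ∃ m : ℕ, 4 * e m < r := by
      obtain ⟨m, hm⟩ := exists_pow_lt_of_lt_one (div_pos hr hε) (by norm_num : (1 / 2 : ℝ) < 1)
      refine ⟨m, ?_⟩
      rw [lt_div_iff₀ hε] at hm
      calc 4 * e m = (1 / 2) ^ m * ε := by simp only [he, one_div, inv_pow]; ring
        _ < r := hm
    refine ⟨(u m).2, (hu m).1, fun n => hrU ?_⟩
    have h1 := hztr m ((u m).2 * n)
    have h2 := hztr m 0
    rw [Nat.mul_mod_right] at h1
    rw [Nat.zero_mod] at h2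
    have := dist_triangle_right (f^[(u m).2 * n] z) (f^[0] z) (f^[0] (u m).1)
    simp only [iterate_zero, id] at *
    rw [Metric.mem_ball]
    linarith
  · have h1 := hztr 0 t
    have h2 := (htr₀ (t % P₀)).le
    have h3 : q (t % P₀) = q t := by
      obtain ⟨c, rfl⟩ := hPP₀
      rw [mul_comm] at *
      exact (hper.nat_mul c).map_mod_nat t
    rw [h3] at h2
    have h4 := dist_triangle (f^[t] z) (f^[t % P₀] y₀) (q t)
    have h5 : (2 : ℝ) * e 0 = ε / 2 := by simp only [he]; ring
    change dist (f^[t] z) (f^[t % P₀] y₀) ≤ _ at h1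
    linarith

/-- The orbit closure of a regularly recurrent point is minimal: every orbit in it visits every
open set meeting it. -/
theorem RegRecPt.exists_iterate_mem [TopologicalSpace X] [RegularSpace X] {f : X → X}
    (hf : Continuous f) {z : X} (hz : RegRecPt f z) {U : Set X} (hU : IsOpen U)
    (hUz : (U ∩ closure (orbitSet f z)).Nonempty) {y : X} (hy : y ∈ closure (orbitSet f z)) :
    ∃ n, f^[n] y ∈ U := by
  obtain ⟨x, hxU, hx⟩ := hUz
  obtain ⟨_, hsU, s, rfl⟩ := mem_closure_iff.1 hx U hU hxU
  obtain ⟨V, hV, hVc, hVU⟩ := exists_mem_nhds_isClosed_subset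
    ((hU.preimage (hf.iterate s)).mem_nhds hsU)
  obtain ⟨k, hk, hkV⟩ := hz V hV
  have hclosed : IsClosed (⋃ r ∈ Finset.range k, f^[r] ⁻¹' V) :=
    isClosed_biUnion_finset fun r _ => hVc.preimage (hf.iterate r)
  have hsub : orbitSet f z ⊆ ⋃ r ∈ Finset.range k, f^[r] ⁻¹' V := by
    rintro _ ⟨t, rfl⟩
    refine mem_biUnion (x := (k - 1 - t % k + 1) % k)
      (Finset.mem_coe.2 (Finset.mem_range.2 (Nat.mod_lt _ hk))) ?_
    have hmod : k ∣ (k - 1 - t % k + 1) % k + t := by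
      rw [Nat.dvd_iff_mod_eq_zero, Nat.mod_add_mod]
      have := Nat.mod_lt t hk
      have h3 := Nat.div_add_mod t k
      rw [show k - 1 - t % k + 1 + t = k + k * (t / k) by omega]
      simp
    obtain ⟨c, hc⟩ := hmod
    rw [mem_preimage, ← iterate_add_apply, hc]
    exact hkV c
  obtain ⟨r, -, hr⟩ := mem_iUnion₂.1 (closure_minimal hsub hclosed hy)
  exact ⟨s + r, by rw [iterate_add_apply]; exact hVU hr⟩
open MeasureTheory Filter Topology ProbabilityTheory BoundedContinuousFunction

/-- A continuous self-map of a nonempty compact space has an invariant probability measure. -/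
theorem exists_map_eq_self {Y : Type*} [MetricSpace Y] [CompactSpace Y] [Nonempty Y]
    [MeasurableSpace Y] [BorelSpace Y] {g : Y → Y} (hg : Continuous g) :
    ∃ ν : ProbabilityMeasure Y, ν.map hg.measurable.aemeasurable = ν := by
  obtain ⟨z⟩ := ‹Nonempty Y›
  let μ : ℕ → Measure Y := fun n =>
    ((n + 1 : ℕ) : ENNReal)⁻¹ • ∑ i ∈ Finset.range (n + 1), Measure.dirac (g^[i] z)
  have hμ : ∀ n, IsProbabilityMeasure (μ n) := fun n => ⟨by
    simp only [μ, Measure.smul_apply, Measure.finsetSum_apply, measure_univ, smul_eq_mul,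
      Finset.sum_const, Finset.card_range, nsmul_eq_mul, mul_one]
    exact ENNReal.inv_mul_cancel (by simp) (ENNReal.natCast_ne_top _)⟩
  have havg : ∀ (φ : Y →ᵇ ℝ) n,
      ∫ y, φ y ∂(μ n) = ((n + 1 : ℕ) : ℝ)⁻¹ * birkhoffSum g φ (n + 1) z := by
    intro φ n
    rw [integral_smul_measure, integral_finsetSum_measure fun i _ => integrable_dirac (by simp)]
    simp only [integral_dirac, ENNReal.toReal_inv, ENNReal.toReal_natCast, smul_eq_mul,
      birkhoffSum]
  let P : ℕ → ProbabilityMeasure Y := fun n => ⟨μ n, hμ n⟩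
  obtain ⟨ν, -, hν⟩ := isCompact_univ.ultrafilter_le_nhds
    (Ultrafilter.map P (hyperfilter ℕ)) (by simp)
  have hν : Tendsto P (hyperfilter ℕ) (𝓝 ν) := hν
  refine ⟨ν, ProbabilityMeasure.toMeasure_injective ?_⟩
  refine ext_of_forall_integral_eq_of_IsFiniteMeasure fun φ => ?_
  rw [ProbabilityMeasure.toMeasure_map,
    integral_map hg.measurable.aemeasurable φ.continuous.aestronglyMeasurable]
  have h1 := ProbabilityMeasure.tendsto_iff_forall_integral_tendsto.1 hν φ
  have h2 := ProbabilityMeasure.tendsto_iff_forall_integral_tendsto.1 hν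
    (φ.compContinuous ⟨g, hg⟩)
  have h3 : Tendsto (fun n => ∫ y, φ (g y) ∂(P n : Measure Y) - ∫ y, φ y ∂(P n : Measure Y))
      (hyperfilter ℕ) (𝓝 0) := by
    refine Tendsto.mono_left ?_ (Nat.hyperfilter_le_atTop)
    refine squeeze_zero_norm (a := fun n : ℕ => 2 * ‖φ‖ * (1 / ((n : ℝ) + 1))) (fun n => ?_) ?_
    · have e1 := havg φ n
      have e2 := havg (φ.compContinuous ⟨g, hg⟩) n
      change ∫ y, φ (g y) ∂(μ n) = _ at e2
      change ‖∫ y, φ (g y) ∂(μ n) - ∫ y, φ y ∂(μ n)‖ ≤ _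
      have e3 : birkhoffSum g (φ.compContinuous ⟨g, hg⟩) (n + 1) z
          = birkhoffSum g φ (n + 1) (g z) := by
        simp only [birkhoffSum]
        exact Finset.sum_congr rfl fun i _ => by
          rw [← iterate_succ_apply, iterate_succ_apply']; rfl
      rw [e1, e2, e3, ← mul_sub, birkhoffSum_apply_sub_birkhoffSum, norm_mul, norm_inv]
      have e4 := norm_sub_le (φ (g^[n + 1] z)) (φ z)
      have e5 := φ.norm_coe_le_norm (g^[n + 1] z)
      have e6 := φ.norm_coe_le_norm z
      have e7 : ‖((n + 1 : ℕ) : ℝ)‖ = (n : ℝ) + 1 := by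
        rw [Real.norm_of_nonneg (by positivity)]; push_cast; rfl
      rw [e7, mul_comm, one_div]
      gcongr
      linarith
    · simpa using tendsto_one_div_add_atTop_nhds_zero_nat.const_mul (2 * ‖φ‖)
  exact sub_eq_zero.1 (tendsto_nhds_unique (h2.sub h1) h3)

/-- A continuous self-map of a nonempty compact space has an ergodic probability measure. -/
theorem exists_ergodic {Y : Type*} [MetricSpace Y] [CompactSpace Y] [Nonempty Y]
    [MeasurableSpace Y] [BorelSpace Y] {g : Y → Y} (hg : Continuous g) :
    ∃ ν : Measure Y, IsProbabilityMeasure ν ∧ Ergodic g ν := by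
  let F : ProbabilityMeasure Y → ((Y →ᵇ ℝ) → ℝ) := fun ν φ => ∫ y, φ y ∂(ν : Measure Y)
  have hF : Continuous F := continuous_pi fun φ => continuous_iff_continuousAt.2 fun ν =>
    ProbabilityMeasure.tendsto_iff_forall_integral_tendsto.1 tendsto_id φ
  let M : Set (ProbabilityMeasure Y) := {ν | ν.map hg.measurable.aemeasurable = ν}
  have hM : IsClosed M := isClosed_eq (ProbabilityMeasure.continuous_map hg) continuous_id
  obtain ⟨_, ⟨ν, hν, rfl⟩, hext⟩ := (hM.isCompact.image hF).extremePoints_nonempty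
    (Set.Nonempty.image F (exists_map_eq_self hg))
  have hmem : ∀ ν' : ProbabilityMeasure Y, MeasurePreserving g (ν' : Measure Y) ν' → ν' ∈ M :=
    fun ν' h => ProbabilityMeasure.toMeasure_injective
      ((ν'.toMeasure_map hg.measurable.aemeasurable).trans h.map_eq)
  refine ⟨ν, inferInstance, Ergodic.of_mem_extremePoints ⟨⟨⟨hg.measurable, ?_⟩, inferInstance⟩, ?_⟩⟩
  · rw [← ν.toMeasure_map hg.measurable.aemeasurable]
    exact congrArg _ hν
  · rintro ν₁ ⟨h₁, hp₁⟩ ν₂ ⟨h₂, hp₂⟩ ⟨a, b, ha, hb, hab, hν'⟩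
    have ha' : a ≠ ⊤ := fun h => by simp [h] at hab
    have hb' : b ≠ ⊤ := fun h => by simp [h] at hab
    have hseg : F ν ∈ openSegment ℝ (F ⟨ν₁, hp₁⟩) (F ⟨ν₂, hp₂⟩) := by
      refine ⟨a.toReal, b.toReal, ENNReal.toReal_pos ha.ne' ha', ENNReal.toReal_pos hb.ne' hb',
        by rw [← ENNReal.toReal_add ha' hb', hab, ENNReal.toReal_one], ?_⟩
      funext φ
      change a.toReal • ∫ y, φ y ∂ν₁ + b.toReal • ∫ y, φ y ∂ν₂ = ∫ y, φ y ∂(ν : Measure Y)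
      rw [← hν', integral_add_measure ((φ.integrable ν₁).smul_measure ha')
        ((φ.integrable ν₂).smul_measure hb'), integral_smul_measure, integral_smul_measure]
    have h := hext ⟨_, hmem ⟨ν₁, hp₁⟩ h₁, rfl⟩ ⟨_, hmem ⟨ν₂, hp₂⟩ h₂, rfl⟩ hseg
    exact ext_of_forall_integral_eq_of_IsFiniteMeasure fun φ => congrFun h φ

/-- The integrals of finitely many functions are simultaneously approximated by averages over
finitely many points. -/
theorem exists_sum_approx_integral {Y ι : Type*} [MeasurableSpace Y] (μ : Measure Y)
    [IsProbabilityMeasure μ] (s : Finset ι) (φ : ι → Y → ℝ) (hφm : ∀ i ∈ s, Measurable (φ i))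
    (hφ : ∀ i ∈ s, Integrable (φ i) μ) {η : ℝ} (hη : 0 < η) :
    ∃ (m : ℕ) (x : ℕ → Y), 1 ≤ m ∧ ∀ i ∈ s,
      |∑ j ∈ Finset.range m, φ i (x j) - m * ∫ y, φ i y ∂μ| ≤ m * η := by
  have hlaw : ∀ i ∈ s, ∀ᵐ ω ∂(Measure.infinitePi fun _ : ℕ => μ), Tendsto
      (fun n : ℕ => (∑ j ∈ Finset.range n, φ i (ω j)) / n) atTop (𝓝 (∫ y, φ i y ∂μ)) := by
    intro i hi
    have hid : ∀ j : ℕ, MeasurePreserving (fun ω : ℕ → Y => ω j)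
        (Measure.infinitePi fun _ : ℕ => μ) μ := fun j =>
      ⟨measurable_pi_apply j, Measure.infinitePi_map_eval _ j⟩
    have h := strong_law_ae_real (μ := Measure.infinitePi fun _ : ℕ => μ)
      (fun j ω => φ i (ω j))
      ((hid 0).integrable_comp_of_integrable (hφ i hi))
      (fun j k hjk => (iIndepFun_infinitePi (P := fun _ : ℕ => μ) (X := fun _ => φ i)
        fun _ => hφm i hi).indepFun hjk)
      (fun j => ⟨((hφm i hi).comp (measurable_pi_apply j)).aemeasurable,
        ((hφm i hi).comp (measurable_pi_apply 0)).aemeasurable, by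
          change Measure.map (φ i ∘ fun ω : ℕ → Y => ω j) _ =
            Measure.map (φ i ∘ fun ω : ℕ → Y => ω 0) _
          rw [← Measure.map_map (hφm i hi) (measurable_pi_apply j),
            ← Measure.map_map (hφm i hi) (measurable_pi_apply 0), (hid j).map_eq,
            (hid 0).map_eq]⟩)
    have heq : ∫ ω, φ i (ω 0) ∂(Measure.infinitePi fun _ : ℕ => μ) = ∫ y, φ i y ∂μ := by
      rw [← (hid 0).map_eq, integral_map (hid 0).aemeasurable
        (hφm i hi).aestronglyMeasurable, (hid 0).map_eq]
    rwa [heq] at h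
  obtain ⟨x, hx⟩ := ((Finset.eventually_all s).2 hlaw).exists
  have hev := (Finset.eventually_all s).2 fun i hi =>
    (Metric.tendsto_nhds.1 (hx i hi)) η hη
  obtain ⟨m, hm, hm1⟩ := (hev.and (eventually_ge_atTop 1)).exists
  refine ⟨m, x, hm1, fun i hi => ?_⟩
  have hm0 : (0 : ℝ) < m := by exact_mod_cast hm1
  have h := (hm i hi).le
  rw [Real.dist_eq] at h
  calc _ = |m * ((∑ j ∈ Finset.range m, φ i (x j)) / m - ∫ y, φ i y ∂μ)| := by
        congr 1; field_simp
    _ ≤ m * η := by rw [abs_mul, abs_of_pos hm0]; gcongr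

/-- A nonempty closed invariant set carries an ergodic probability measure. -/
theorem exists_ergodic_measure_compl_eq_zero [MetricSpace X] [CompactSpace X] [MeasurableSpace X]
    [BorelSpace X] {f : X → X} (hf : Continuous f) {K : Set X} (hK : IsClosed K)
    (hKn : K.Nonempty) (hKf : MapsTo f K K) :
    ∃ ν : ProbabilityMeasure X, Ergodic f (ν : Measure X) ∧ (ν : Measure X) Kᶜ = 0 := by
  have : CompactSpace K := isCompact_iff_compactSpace.1 hK.isCompact
  have : Nonempty K := hKn.to_subtype
  obtain ⟨ν, hν, hνe⟩ := exists_ergodic (hf.restrict hKf)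
  have hm : Measurable (Subtype.val : K → X) := measurable_subtype_coe
  refine ⟨⟨ν.map Subtype.val, Measure.isProbabilityMeasure_map hm.aemeasurable⟩, ?_, ?_⟩
  · exact MeasurePreserving.ergodic_of_ergodic_semiconj ⟨hm, rfl⟩ hνe hf.measurable fun _ => rfl
  · change ν.map Subtype.val Kᶜ = 0
    rw [Measure.map_apply hm hK.measurableSet.compl]
    simp

theorem measSupport_eq_orbitClosure [MetricSpace X] [MeasurableSpace X] [BorelSpace X]
    {f : X → X} (hf : Continuous f) {z : X} (hz : RegRecPt f z) {ν : ProbabilityMeasure X}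
    (hν : MeasurePreserving f (ν : Measure X) ν)
    (hK : (ν : Measure X) (closure (orbitSet f z))ᶜ = 0) :
    measSupport (ν : Measure X) = closure (orbitSet f z) := by
  refine Subset.antisymm (fun x hx => ?_) fun x hx U hU => ?_
  · by_contra hxK
    exact (hx _ (isClosed_closure.isOpen_compl.mem_nhds hxK)).ne' hK
  · rw [pos_iff_ne_zero]
    intro hU0
    obtain ⟨V, hVU, hV, hxV⟩ := mem_nhds_iff.1 hU
    have hV0 : (ν : Measure X) V = 0 := measure_mono_null hVU hU0
    have hcov : (univ : Set X) ⊆ (closure (orbitSet f z))ᶜ ∪ ⋃ n : ℕ, f^[n] ⁻¹' V := by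
      intro y _
      by_cases hy : y ∈ closure (orbitSet f z)
      · exact Or.inr (mem_iUnion.2 (RegRecPt.exists_iterate_mem hf hz hV ⟨x, hxV, hx⟩ hy))
      · exact Or.inl hy
    have h0 : (ν : Measure X) univ = 0 := measure_mono_null hcov
      (measure_union_null hK (measure_iUnion_null fun n => by
        rw [(hν.iterate n).measure_preimage hV.measurableSet.nullMeasurableSet, hV0]))
    simp at h0

/-- If the orbit of `z` follows a `T`-periodic sequence along which `φ` is controlled, then the
sums of `φ` over `T` consecutive times are controlled on the orbit closure of `z`. -/
theorem abs_birkhoffSum_sub_le_of_mem_closure [TopologicalSpace X] {f : X → X}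
    (hf : Continuous f) {φ : X → ℝ} (hφ : Continuous φ) {z : X} {q : ℕ → X} {T : ℕ}
    (hq : Periodic q T) {η : ℝ} (hz : ∀ t, |φ (f^[t] z) - φ (q t)| ≤ η) {y : X}
    (hy : y ∈ closure (orbitSet f z)) :
    |birkhoffSum f φ T y - ∑ i ∈ Finset.range T, φ (q i)| ≤ T * η := by
  have hcont : Continuous (birkhoffSum f φ T) := by
    unfold birkhoffSum
    exact continuous_finsetSum _ fun i _ => hφ.comp (hf.iterate i)
  have hclosed : IsClosed {y | |birkhoffSum f φ T y - ∑ i ∈ Finset.range T, φ (q i)| ≤ T * η} :=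
    isClosed_le (by fun_prop) continuous_const
  refine closure_minimal ?_ hclosed hy
  rintro _ ⟨s, rfl⟩
  have hshift : ∀ s, ∑ i ∈ Finset.range T, φ (q (i + s)) = ∑ i ∈ Finset.range T, φ (q i) := by
    intro s
    induction s with
    | zero => rfl
    | succ s ih =>
      have h := Finset.sum_range_succ (fun i => φ (q (i + s))) T
      rw [Finset.sum_range_succ'] at h
      simp only [zero_add, add_comm T s, hq s, add_left_inj, ih] at h
      rw [← h]
      exact Finset.sum_congr rfl fun i _ => by congr 2; ring
  change |birkhoffSum f φ T (f^[s] z) - _| ≤ _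
  rw [← hshift s, birkhoffSum, ← Finset.sum_sub_distrib]
  calc _ ≤ ∑ i ∈ Finset.range T, |φ (f^[i] (f^[s] z)) - φ (q (i + s))| :=
        Finset.abs_sum_le_sum_abs _ _
    _ ≤ ∑ _i ∈ Finset.range T, η := Finset.sum_le_sum fun i _ => by
        rw [← iterate_add_apply]; exact hz _
    _ = T * η := by simp

theorem integral_birkhoffSum [TopologicalSpace X] [MeasurableSpace X] [BorelSpace X]
    {f : X → X} {μ : Measure X} [IsFiniteMeasure μ] (hf : MeasurePreserving f μ μ)
    (φ : X →ᵇ ℝ) (T : ℕ) :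
    Integrable (birkhoffSum f φ T) μ ∧ ∫ y, birkhoffSum f φ T y ∂μ = T * ∫ y, φ y ∂μ := by
  have hi : ∀ i, Integrable (fun y => φ (f^[i] y)) μ := fun i =>
    (hf.iterate i).integrable_comp_of_integrable (φ.integrable μ)
  refine ⟨integrable_finsetSum _ fun i _ => hi i, ?_⟩
  simp only [birkhoffSum]
  rw [integral_finsetSum _ fun i _ => hi i, Finset.sum_congr rfl fun i _ => ?_,
    Finset.sum_const, Finset.card_range, nsmul_eq_mul]
  have h := (hf.iterate i).map_eq
  conv_rhs => rw [← h]
  rw [integral_map (hf.iterate i).aemeasurable φ.continuous.aestronglyMeasurable]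

theorem exists_ergodic_forall_abs_integral_sub_lt [MetricSpace X] [CompactSpace X]
    [MeasurableSpace X] [BorelSpace X] {f : X → X} (hf : Continuous f) (htr : TopTransitive f)
    (hsh : HasShadowing f) {μ : Measure X} [IsProbabilityMeasure μ]
    (hμ : MeasurePreserving f μ μ) (s : Finset (X →ᵇ ℝ)) {η : ℝ} (hη : 0 < η) :
    ∃ ν : ProbabilityMeasure X, (Ergodic f (ν : Measure X) ∧
      ∃ z, RegRecPt f z ∧ measSupport (ν : Measure X) = closure (orbitSet f z)) ∧
      ∀ φ ∈ s, |∫ y, φ y ∂(ν : Measure X) - ∫ y, φ y ∂μ| < η := by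
  obtain ⟨ε, hε, hεs⟩ : ∃ ε > 0, ∀ φ ∈ s, ∀ a b : X, dist a b ≤ ε → |φ a - φ b| ≤ η / 4 := by
    have h : ∀ φ ∈ s, ∀ᶠ ε in 𝓝[>] (0 : ℝ), ∀ a b : X, dist a b ≤ ε → |φ a - φ b| ≤ η / 4 := by
      intro φ _
      obtain ⟨ε, hε, h⟩ := Metric.uniformContinuous_iff.1
        (CompactSpace.uniformContinuous_of_continuous φ.continuous) (η / 4) (by linarith)
      filter_upwards [Ioo_mem_nhdsGT hε] with r hr a b hab
      exact (h (hab.trans_lt hr.2)).le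
    obtain ⟨ε, h1, h2⟩ := (((Finset.eventually_all s).2 h).and self_mem_nhdsWithin).exists
    exact ⟨ε, h2, h1⟩
  obtain ⟨δ, hδ, hδz⟩ := exists_regRecPt_tracing hf hsh hε
  obtain ⟨L, hL⟩ := exists_isPseudoSegment_of_topTransitive htr hδ
  set C : ℝ := ∑ φ ∈ s, ‖φ‖
  have hC : ∀ φ ∈ s, ‖φ‖ ≤ C := fun φ hφ =>
    Finset.single_le_sum (f := fun φ : X →ᵇ ℝ => ‖φ‖) (fun _ _ => norm_nonneg _) hφ
  obtain ⟨N, hN⟩ := exists_nat_ge (max 1 (2 * C * L / (η / 4)))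
  have hN1 : (1 : ℝ) ≤ N := (le_max_left _ _).trans hN
  have hNC : 2 * C * L ≤ N * (η / 4) :=
    (div_le_iff₀ (by linarith)).1 ((le_max_right _ _).trans hN)
  obtain ⟨m, x, hm, hx⟩ := exists_sum_approx_integral μ s (fun φ => birkhoffSum f φ N)
    (fun φ _ => by
      unfold birkhoffSum
      exact Finset.measurable_fun_sum _ fun i _ =>
        (φ.continuous.comp (hf.iterate i)).measurable)
    (fun φ _ => (integral_birkhoffSum hμ φ N).1) (η := N * (η / 4)) (by positivity)
  obtain ⟨T, q, hq, hTl, hTu, hqφ⟩ := exists_isPseudoSegment_through hδ hL N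
    (fun j => if j < m then x j else x 0) m
  have hT1 : 1 ≤ T := by
    have : 1 ≤ N := by exact_mod_cast hN1
    exact (Nat.mul_pos hm this).trans_le hTl
  rw [if_neg (lt_irrefl m), ite_self] at hq
  have hper : Periodic (fun t => q (t % T)) T := fun t => by simp
  obtain ⟨z, hz, hztr⟩ := hδz _ T (isPseudoOrbit_mod hT1 hq) hT1 hper
  have hinv : MapsTo f (closure (orbitSet f z)) (closure (orbitSet f z)) := by
    refine MapsTo.closure ?_ hf
    rintro _ ⟨n, rfl⟩
    exact ⟨n + 1, iterate_succ_apply' f n z⟩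
  obtain ⟨ν, hνe, hνK⟩ := exists_ergodic_measure_compl_eq_zero hf isClosed_closure
    ⟨z, subset_closure (s := orbitSet f z) ⟨0, rfl⟩⟩ hinv
  refine ⟨ν, ⟨hνe, z, hz, measSupport_eq_orbitClosure hf hz hνe.toMeasurePreserving hνK⟩,
    fun φ hφ => ?_⟩
  obtain ⟨hνi, hνI⟩ := integral_birkhoffSum hνe.toMeasurePreserving φ T
  set V := ∑ i ∈ Finset.range T, φ (q i)
  set I := ∫ y, φ y ∂μ
  have hsum : ∑ i ∈ Finset.range T, φ (q (i % T)) = V :=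
    Finset.sum_congr rfl fun i hi => by rw [Nat.mod_eq_of_lt (Finset.mem_range.1 hi)]
  have hνV : |T * ∫ y, φ y ∂(ν : Measure X) - V| ≤ T * (η / 4) := by
    have hae : ∀ᵐ y ∂(ν : Measure X), ‖birkhoffSum f φ T y - V‖ ≤ T * (η / 4) := by
      filter_upwards [mem_ae_iff.2 hνK] with y hy
      rw [← hsum]
      exact abs_birkhoffSum_sub_le_of_mem_closure hf φ.continuous hper
        (fun t => hεs φ hφ _ _ (hztr t)) hy
    have h := norm_integral_le_of_norm_le_const hae
    rw [integral_sub hνi (integrable_const _), hνI] at h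
    simpa using h
  have hφC : ∀ y, |φ y| ≤ C := fun y => (φ.norm_coe_le_norm y).trans (hC φ hφ)
  have hVW := hqφ φ C hφC
  have hxs := hx φ hφ
  rw [(integral_birkhoffSum hμ φ N).2] at hxs
  have hsame : ∑ j ∈ Finset.range m, birkhoffSum f φ N (if j < m then x j else x 0)
      = ∑ j ∈ Finset.range m, birkhoffSum f φ N (x j) :=
    Finset.sum_congr rfl fun j hj => by rw [if_pos (Finset.mem_range.1 hj)]
  rw [hsame] at hVW
  have hIC : |I| ≤ C := by
    have h := norm_integral_le_of_norm_le_const (μ := μ) (f := φ) (C := C)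
      (Filter.Eventually.of_forall fun y => hφC y)
    simpa using h
  have hTl' : (m : ℝ) * N ≤ T := by exact_mod_cast hTl
  have hTu' : (T : ℝ) ≤ m * (N + L) := by exact_mod_cast hTu
  have hm0 : (0 : ℝ) ≤ m := m.cast_nonneg
  have hgap : |((T : ℝ) - m * N) * I| ≤ m * L * C := by
    rw [abs_mul, abs_of_nonneg (by linarith)]
    have : (T : ℝ) - m * N ≤ m * L := by linarith
    gcongr
  have hmC : m * (2 * C * L) ≤ m * (N * (η / 4)) := by gcongr
  have hTη : m * N * (η / 4) ≤ T * (η / 4) := by gcongr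
  have hT0 : (0 : ℝ) < T := by exact_mod_cast hT1
  have hTpos : 0 < T * (η / 4) := by positivity
  have hfinal : |T * (∫ y, φ y ∂(ν : Measure X) - I)| < T * η := by
    rw [abs_le] at *
    rw [abs_lt]
    constructor <;> nlinarith
  rw [abs_mul, abs_of_pos hT0] at hfinal
  exact lt_of_mul_lt_mul_left hfinal hT0.le

end RegRecDensity

theorem dense_ergodic_measures_on_regrec_orbit_closures
    [MetricSpace X] [CompactSpace X] [MeasurableSpace X] [BorelSpace X]
    (f : X → X) (hf : Continuous f) (hwm : WeaklyMixing f) (hsh : HasShadowing f) :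
    {μ : MeasureTheory.ProbabilityMeasure X |
        MeasureTheory.Measure.map f μ.toMeasure = μ.toMeasure} ⊆
      closure {ν : MeasureTheory.ProbabilityMeasure X |
        Ergodic f ν.toMeasure ∧
        ∃ z : X, RegRecPt f z ∧ measSupport ν.toMeasure = closure (orbitSet f z)} := by
  classical
  intro μ hμ
  have hμf : MeasureTheory.MeasurePreserving f μ.toMeasure μ.toMeasure := ⟨hf.measurable, hμ⟩
  choose ν hν hνs using fun p : Finset (BoundedContinuousFunction X ℝ) × ℕ =>
    RegRecDensity.exists_ergodic_forall_abs_integral_sub_lt hf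
      (RegRecDensity.TopTransitive.of_weaklyMixing hwm) hsh hμf p.1
      (Nat.one_div_pos_of_nat (α := ℝ) (n := p.2))
  refine mem_closure_of_tendsto (f := ν) (b := Filter.atTop) ?_ (Filter.Eventually.of_forall hν)
  refine MeasureTheory.ProbabilityMeasure.tendsto_iff_forall_integral_tendsto.2 fun φ => ?_
  refine Metric.tendsto_nhds.2 fun η hη => ?_
  obtain ⟨n, hn⟩ := exists_nat_one_div_lt hη
  filter_upwards [Filter.eventually_ge_atTop (({φ}, n) : Finset _ × ℕ)] with p hp
  rw [Real.dist_eq]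
  refine (hνs p φ (hp.1 (Finset.mem_singleton_self φ))).trans_le (le_trans ?_ hn.le)
  exact Nat.one_div_le_one_div hp.2
end
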